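/- arXiv:1812.07746 — 2 statements merged into one kernel-verified Lean document; each statement's English description precedes it below -/
import Mathlib

section
/- For every a ∈ I^im and every (ν,J) ∈ RC(∞): if κ_a(ν,J) = 0 then f_a(ν,J) = f_a^*(ν,J); and if κ_a(ν,J) > 0 then tε_a^*(f_a(ν,J)) = tε_a^*(ν,J). -/
/-! Rigged configurations for generalized Kac–Moody (Borcherds) algebras. -/

/-- A Borcherds–Cartan matrix: integer matrix with `A a a = 2` or `A a a` nonpositive even,
nonpositive off-diagonal entries, and `A a b = 0 ↔ A b a = 0`. -/
structure IsBorcherdsCartan {I : Type*} (A : I → I → ℤ) : Prop where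
  diag : ∀ a, A a a = 2 ∨ (A a a ≤ 0 ∧ Even (A a a))
  offdiag : ∀ a b, a ≠ b → A a b ≤ 0
  zero_iff : ∀ a b, A a b = 0 ↔ A b a = 0

/-- A (raw) rigged configuration: for each color `a ∈ I`, a multiset of pairs
`(row length, rigging)`.  Rows of length `0` with rigging `0` are treated implicitly by the
operators below. -/
abbrev RCraw (I : Type*) := I → Multiset (ℕ × ℤ)

variable {I : Type*} [DecidableEq I]

/-- The empty rigged configuration `(ν_∅, J_∅)`. -/
def emptyRC : RCraw I := fun _ => 0

/-- `|ν^(b)|`, the number of boxes of color `b`. -/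
def rcSize (ν : RCraw I) (b : I) : ℤ := ((ν b).map fun p => (p.1 : ℤ)).sum

/-- The vacancy number `p_i^(a) = -∑_b A a b ∑_{rows j of ν^(b)} min i j`. -/
noncomputable def vac (A : I → I → ℤ) (ν : RCraw I) (a : I) (i : ℕ) : ℤ :=
  -∑ᶠ b, A a b * ((ν b).map fun p => (min i p.1 : ℤ)).sum

/-- The limiting vacancy number `p_∞^(a) = -∑_b A a b |ν^(b)| = ⟨h_a, wt(ν,J)⟩`. -/
noncomputable def pInf (A : I → I → ℤ) (ν : RCraw I) (a : I) : ℤ :=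
  -∑ᶠ b, A a b * rcSize ν b

/-- Minimum of a multiset of integers together with `0` (the rigging of the implicit
length-`0` rows). -/
def minWith0 (s : Multiset ℤ) : ℤ := s.fold min 0

/-- Minimum of a nonempty multiset of integers (junk value `0` on the empty multiset). -/
def minPosRows (s : Multiset ℤ) : ℤ := s.fold min (s.fold max 0)

/-- Maximum of a multiset of naturals together with `0`. -/
def maxWith0 (s : Multiset ℕ) : ℕ := s.fold max 0

/-- Minimum of a nonempty multiset of naturals (junk value on the empty multiset). -/
def minPosRowsN (s : Multiset ℕ) : ℕ := s.fold min (s.fold max 0)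

/-- The crystal operator `f_a` on rigged configurations: add a box to a row of maximal
length among the rows of `ν^(a)` whose rigging equals the smallest rigging `x` (with the
length-`0` rows of rigging `0` included), give the new row the rigging `x - A a a / 2`, and
change all other riggings so that the coriggings are preserved. -/
def fOp (A : I → I → ℤ) (a : I) (ν : RCraw I) : RCraw I :=
  let M := ν a
  let x := minWith0 (M.map Prod.snd)
  let ℓ := maxWith0 ((M.filter fun p => p.2 = x).map Prod.fst)
  fun b =>
    let adj : Multiset (ℕ × ℤ) → Multiset (ℕ × ℤ) :=
      Multiset.map fun p => (p.1, p.2 - if ℓ < p.1 then A b a else 0)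
    if b = a then adj (M.erase (ℓ, x)) + {(ℓ + 1, x - A a a / 2)} else adj (ν b)

/-- Auxiliary for `eOp`: remove a box from a row of minimal (positive) length among the
rows of `ν^(a)` with rigging `x`, give it the rigging `x + A a a / 2` (dropping the row if
its length becomes `0`), and change all other riggings so that the coriggings are
preserved. -/
def eRemove (A : I → I → ℤ) (a : I) (ν : RCraw I) (x : ℤ) : RCraw I :=
  let M := ν a
  let ℓ := minPosRowsN ((M.filter fun p => p.2 = x).map Prod.fst)
  fun b =>
    let adj : Multiset (ℕ × ℤ) → Multiset (ℕ × ℤ) :=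
      Multiset.map fun p => (p.1, p.2 + if ℓ ≤ p.1 then A b a else 0)
    if b = a then
      adj (M.erase (ℓ, x)) + (if ℓ = 1 then 0 else {(ℓ - 1, x + A a a / 2)})
    else adj (ν b)

/-- The crystal operator `e_a` on rigged configurations. -/
def eOp (A : I → I → ℤ) (a : I) (ν : RCraw I) : Option (RCraw I) :=
  if A a a = 2 then
    let x := minWith0 ((ν a).map Prod.snd)
    if x = 0 then none else some (eRemove A a ν x)
  else
    if ν a = 0 ∨ minPosRows ((ν a).map Prod.snd) ≠ -A a a / 2 then none
    else some (eRemove A a ν (-A a a / 2))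

/-- The multiset of coriggings `p_i^(a) - x` of the (positive length) rows of `ν^(a)`. -/
noncomputable def corigs (A : I → I → ℤ) (ν : RCraw I) (a : I) : Multiset ℤ :=
  (ν a).map fun p => vac A ν a p.1 - p.2

open scoped Classical in
/-- The star crystal operator `f_a^*`: add a box to a row of maximal length among the rows
of `ν^(a)` whose corigging equals the smallest corigging `x` (with the length-`0` rows of
corigging `0` included), set the rigging of the new row so that its corigging is
`x - A a a / 2`, and keep all other riggings fixed. -/
noncomputable def fStar (A : I → I → ℤ) (a : I) (ν : RCraw I) : RCraw I :=
  let M := ν a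
  let x := minWith0 (corigs A ν a)
  let ℓ := maxWith0 ((M.filter fun p => vac A ν a p.1 - p.2 = x).map Prod.fst)
  fun b =>
    if b = a then
      M.erase (ℓ, vac A ν a ℓ - x) + {(ℓ + 1, (vac A ν a (ℓ + 1) - A a a) - (x - A a a / 2))}
    else ν b

open scoped Classical in
/-- Auxiliary for `eStarOp`: remove a box from a row of minimal (positive) length among
the rows of `ν^(a)` with corigging `x`, set its rigging so that its corigging is
`x - A a a / 2` (dropping the row if its length becomes `0`), and keep all other riggings
fixed. -/
noncomputable def eStarRemove (A : I → I → ℤ) (a : I) (ν : RCraw I) (x : ℤ) : RCraw I :=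
  let M := ν a
  let ℓ := minPosRowsN ((M.filter fun p => vac A ν a p.1 - p.2 = x).map Prod.fst)
  fun b =>
    if b = a then
      M.erase (ℓ, vac A ν a ℓ - x) +
        (if ℓ = 1 then 0 else {(ℓ - 1, vac A ν a (ℓ - 1) - (x - A a a / 2))})
    else ν b

/-- The star crystal operator `e_a^*`. -/
noncomputable def eStarOp (A : I → I → ℤ) (a : I) (ν : RCraw I) : Option (RCraw I) :=
  if A a a = 2 then
    let x := minWith0 (corigs A ν a)
    if x = 0 then none else some (eStarRemove A a ν x)
  else
    if ν a = 0 ∨ minPosRows (corigs A ν a) ≠ -A a a / 2 then none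
    else some (eStarRemove A a ν (-A a a / 2))

/-- `RC(∞)`: the set of rigged configurations generated from the empty rigged
configuration by the operators `e_a`, `f_a`. -/
inductive RCinf (A : I → I → ℤ) : RCraw I → Prop
  | empty : RCinf A emptyRC
  | fstep (a : I) (ν : RCraw I) : RCinf A ν → RCinf A (fOp A a ν)
  | estep (a : I) (ν ν' : RCraw I) : RCinf A ν → eOp A a ν = some ν' → RCinf A ν'

/-- `RC(∞)^*`: the set of rigged configurations generated from the empty rigged
configuration by the operators `e_a^*`, `f_a^*`. -/
inductive RCinfStar (A : I → I → ℤ) : RCraw I → Prop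
  | empty : RCinfStar A emptyRC
  | fstep (a : I) (ν : RCraw I) : RCinfStar A ν → RCinfStar A (fStar A a ν)
  | estep (a : I) (ν ν' : RCraw I) : RCinfStar A ν → eStarOp A a ν = some ν' → RCinfStar A ν'

/-- Iteration of a partial map. -/
def iterOpt {α : Type*} (g : α → Option α) : ℕ → α → Option α
  | 0, v => some v
  | k + 1, v => (iterOpt g k v).bind g

/-- `tε_a(ν,J) = max {k | e_a^k (ν,J) ≠ 0}`. -/
noncomputable def teRC (A : I → I → ℤ) (a : I) (ν : RCraw I) : ℕ :=
  sSup {k | iterOpt (eOp A a) k ν ≠ none}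

/-- `tε_a^*(ν,J) = max {k | (e_a^*)^k (ν,J) ≠ 0}`. -/
noncomputable def teStarRC (A : I → I → ℤ) (a : I) (ν : RCraw I) : ℕ :=
  sSup {k | iterOpt (eStarOp A a) k ν ≠ none}

/-- `ε_a`: for real `a` the maximal number of applications of `e_a`, for imaginary `a`
zero. -/
noncomputable def epsRC (A : I → I → ℤ) (a : I) (ν : RCraw I) : ℤ :=
  if A a a = 2 then (teRC A a ν : ℤ) else 0

/-- `φ_a(ν,J) = ⟨h_a, wt(ν,J)⟩ + ε_a(ν,J)`. -/
noncomputable def phiRC (A : I → I → ℤ) (a : I) (ν : RCraw I) : ℤ :=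
  pInf A ν a + epsRC A a ν

/-- `ε_a^*`: for real `a` the maximal number of applications of `e_a^*`, for imaginary `a`
zero. -/
noncomputable def epsStarRC (A : I → I → ℤ) (a : I) (ν : RCraw I) : ℤ :=
  if A a a = 2 then (teStarRC A a ν : ℤ) else 0

/-- `φ_a^*(ν,J) = ⟨h_a, wt(ν,J)⟩ + ε_a^*(ν,J)`. -/
noncomputable def phiStarRC (A : I → I → ℤ) (a : I) (ν : RCraw I) : ℤ :=
  pInf A ν a + epsStarRC A a ν

/-- The weight of a rigged configuration, as the coefficient function of
`-∑_a |ν^(a)| α_a`. -/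
def wtRC (ν : RCraw I) : I → ℤ := fun b => -rcSize ν b

/-- For imaginary `a`, `κ_a(ν,J) = tε_a^*(ν,J)·A a a + ⟨h_a, wt(ν,J)⟩`. -/
noncomputable def kappaRC (A : I → I → ℤ) (a : I) (ν : RCraw I) : ℤ :=
  (teStarRC A a ν : ℤ) * A a a + pInf A ν a

/-- For imaginary `a`, `κ_a^*(ν,J) = tε_a(ν,J)·A a a + ⟨h_a, wt(ν,J)⟩`. -/
noncomputable def kappaStarRC (A : I → I → ℤ) (a : I) (ν : RCraw I) : ℤ :=
  (teRC A a ν : ℤ) * A a a + pInf A ν a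



/-! ### Multiset helpers -/

namespace RCProof

theorem fold_min_props (s : Multiset ℤ) (d : ℤ) :
    s.fold min d ≤ d ∧ (∀ z ∈ s, s.fold min d ≤ z) ∧ (s.fold min d = d ∨ s.fold min d ∈ s) := by
  induction s using Multiset.induction_on with
  | empty => simp
  | cons a s ih =>
    obtain ⟨h1, h2, h3⟩ := ih
    rw [Multiset.fold_cons_left]
    refine ⟨le_trans (min_le_right _ _) h1, ?_, ?_⟩
    · intro z hz
      rcases Multiset.mem_cons.1 hz with rfl | hz
      · exact min_le_left _ _
      · exact le_trans (min_le_right _ _) (h2 z hz)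
    · rcases min_choice a (s.fold min d) with h | h <;> rw [h]
      · right; exact Multiset.mem_cons_self _ _
      · rcases h3 with h3 | h3
        · left; exact h3
        · right; exact Multiset.mem_cons_of_mem h3

theorem fold_max_props (s : Multiset ℤ) (d : ℤ) :
    (∀ z ∈ s, z ≤ s.fold max d) := by
  induction s using Multiset.induction_on with
  | empty => simp
  | cons a s ih =>
    rw [Multiset.fold_cons_left]
    intro z hz
    rcases Multiset.mem_cons.1 hz with rfl | hz
    · exact le_max_left _ _
    · exact le_trans (ih z hz) (le_max_right _ _)

theorem fold_min_propsN (s : Multiset ℕ) (d : ℕ) :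
    s.fold min d ≤ d ∧ (∀ z ∈ s, s.fold min d ≤ z) ∧ (s.fold min d = d ∨ s.fold min d ∈ s) := by
  induction s using Multiset.induction_on with
  | empty => simp
  | cons a s ih =>
    obtain ⟨h1, h2, h3⟩ := ih
    rw [Multiset.fold_cons_left]
    refine ⟨le_trans (min_le_right _ _) h1, ?_, ?_⟩
    · intro z hz
      rcases Multiset.mem_cons.1 hz with rfl | hz
      · exact min_le_left _ _
      · exact le_trans (min_le_right _ _) (h2 z hz)
    · rcases min_choice a (s.fold min d) with h | h <;> rw [h]
      · right; exact Multiset.mem_cons_self _ _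
      · rcases h3 with h3 | h3
        · left; exact h3
        · right; exact Multiset.mem_cons_of_mem h3

theorem fold_max_propsN (s : Multiset ℕ) (d : ℕ) :
    d ≤ s.fold max d ∧ (∀ z ∈ s, z ≤ s.fold max d) ∧ (s.fold max d = d ∨ s.fold max d ∈ s) := by
  induction s using Multiset.induction_on with
  | empty => simp
  | cons a s ih =>
    obtain ⟨h1, h2, h3⟩ := ih
    rw [Multiset.fold_cons_left]
    refine ⟨le_trans h1 (le_max_right _ _), ?_, ?_⟩
    · intro z hz
      rcases Multiset.mem_cons.1 hz with rfl | hz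
      · exact le_max_left _ _
      · exact le_trans (h2 z hz) (le_max_right _ _)
    · rcases max_choice a (s.fold max d) with h | h <;> rw [h]
      · right; exact Multiset.mem_cons_self _ _
      · rcases h3 with h3 | h3
        · left; exact h3
        · right; exact Multiset.mem_cons_of_mem h3

theorem minWith0_eq {s : Multiset ℤ} {x : ℤ} (h0 : x ≤ 0) (h1 : ∀ z ∈ s, x ≤ z)
    (h2 : x = 0 ∨ x ∈ s) : minWith0 s = x := by
  obtain ⟨a1, a2, a3⟩ := fold_min_props s 0
  unfold minWith0
  apply le_antisymm
  · rcases h2 with rfl | h2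
    · exact a1
    · exact a2 _ h2
  · rcases a3 with a3 | a3
    · rw [a3]; exact h0
    · exact h1 _ a3

theorem maxWith0_eq {s : Multiset ℕ} {x : ℕ} (h1 : ∀ z ∈ s, z ≤ x)
    (h2 : x = 0 ∨ x ∈ s) : maxWith0 s = x := by
  obtain ⟨a1, a2, a3⟩ := fold_max_propsN s 0
  unfold maxWith0
  apply le_antisymm
  · rcases a3 with a3 | a3
    · rw [a3]; exact Nat.zero_le _
    · exact h1 _ a3
  · rcases h2 with rfl | h2
    · exact a1
    · exact a2 _ h2

theorem minPosRows_spec {s : Multiset ℤ} (hs : s ≠ 0) :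
    minPosRows s ∈ s ∧ ∀ z ∈ s, minPosRows s ≤ z := by
  obtain ⟨a1, a2, a3⟩ := fold_min_props s (s.fold max 0)
  refine ⟨?_, a2⟩
  rcases a3 with a3 | a3
  · obtain ⟨w, hw⟩ := Multiset.exists_mem_of_ne_zero hs
    have h1 := fold_max_props s 0 w hw
    have h2 := a2 w hw
    have : minPosRows s = w := by
      unfold minPosRows
      omega
    rw [this]; exact hw
  · exact a3

theorem minPosRows_eq {s : Multiset ℤ} {x : ℤ} (hx : x ∈ s) (h : ∀ z ∈ s, x ≤ z) :
    minPosRows s = x := by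
  have hs : s ≠ 0 := by rintro rfl; simp at hx
  obtain ⟨h1, h2⟩ := minPosRows_spec hs
  exact le_antisymm (h2 _ hx) (h _ h1)

theorem minPosRowsN_spec {s : Multiset ℕ} (hs : s ≠ 0) :
    minPosRowsN s ∈ s ∧ ∀ z ∈ s, minPosRowsN s ≤ z := by
  obtain ⟨a1, a2, a3⟩ := fold_min_propsN s (s.fold max 0)
  refine ⟨?_, a2⟩
  rcases a3 with a3 | a3
  · obtain ⟨w, hw⟩ := Multiset.exists_mem_of_ne_zero hs
    have h1 := (fold_max_propsN s 0).2.1 w hw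
    have h2 := a2 w hw
    have : minPosRowsN s = w := by
      unfold minPosRowsN
      omega
    rw [this]; exact hw
  · exact a3

theorem minPosRowsN_eq {s : Multiset ℕ} {x : ℕ} (hx : x ∈ s) (h : ∀ z ∈ s, x ≤ z) :
    minPosRowsN s = x := by
  have hs : s ≠ 0 := by rintro rfl; simp at hx
  obtain ⟨h1, h2⟩ := minPosRowsN_spec hs
  exact le_antisymm (h2 _ hx) (h _ h1)

/-! ### Removing zero rows and shifting riggings -/

/-- Drop the rows of length zero. -/
def cl (M : Multiset (ℕ × ℤ)) : Multiset (ℕ × ℤ) := M.filter fun p => 0 < p.1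

/-- All rows have positive length. -/
def Pos (M : Multiset (ℕ × ℤ)) : Prop := ∀ p ∈ M, 0 < p.1

/-- Shift the riggings of the rows longer than `l` by `-s`. -/
def sh (s : ℤ) (l : ℕ) (M : Multiset (ℕ × ℤ)) : Multiset (ℕ × ℤ) :=
  M.map fun p => (p.1, p.2 - if l < p.1 then s else 0)

theorem cl_eq {M : Multiset (ℕ × ℤ)} (h : Pos M) : cl M = M := Multiset.filter_eq_self.2 h

theorem pos_cl (M : Multiset (ℕ × ℤ)) : Pos (cl M) := fun _ hp => (Multiset.mem_filter.1 hp).2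

theorem mem_cl {M : Multiset (ℕ × ℤ)} {p : ℕ × ℤ} : p ∈ cl M ↔ p ∈ M ∧ 0 < p.1 :=
  Multiset.mem_filter

theorem cl_cons_pos {l : ℕ} {x : ℤ} {M : Multiset (ℕ × ℤ)} (h : 0 < l) :
    cl ((l, x) ::ₘ M) = (l, x) ::ₘ cl M := Multiset.filter_cons_of_pos _ h

theorem cl_cons_zero {x : ℤ} {M : Multiset (ℕ × ℤ)} :
    cl ((0, x) ::ₘ M) = cl M := Multiset.filter_cons_of_neg _ (by simp)

theorem cl_add (M N : Multiset (ℕ × ℤ)) : cl (M + N) = cl M + cl N := Multiset.filter_add _ _ _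

theorem cl_cons (p : ℕ × ℤ) (M : Multiset (ℕ × ℤ)) : cl (p ::ₘ M) = cl {p} + cl M := by
  rw [← cl_add, Multiset.singleton_add]

theorem cl_cl (M : Multiset (ℕ × ℤ)) : cl (cl M) = cl M := cl_eq (pos_cl M)

theorem sh_cl (s : ℤ) (l : ℕ) (M : Multiset (ℕ × ℤ)) : sh s l (cl M) = cl (sh s l M) := by
  unfold sh cl
  rw [Multiset.filter_map]
  rfl

theorem sh_cons (s : ℤ) (l : ℕ) (p : ℕ × ℤ) (M : Multiset (ℕ × ℤ)) :
    sh s l (p ::ₘ M) = (p.1, p.2 - if l < p.1 then s else 0) ::ₘ sh s l M := by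
  simp [sh]

theorem sh_add (s : ℤ) (l : ℕ) (M N : Multiset (ℕ × ℤ)) :
    sh s l (M + N) = sh s l M + sh s l N := by
  simp [sh]

theorem sh_zero (l : ℕ) (M : Multiset (ℕ × ℤ)) : sh 0 l M = M := by
  simp [sh]

theorem sh_sh_neg (s : ℤ) (l : ℕ) (M : Multiset (ℕ × ℤ)) : sh s l (sh (-s) l M) = M := by
  unfold sh
  rw [Multiset.map_map]
  conv_rhs => rw [← Multiset.map_id M]
  apply Multiset.map_congr rfl
  intro p _
  ext
  · simp
  · simp only [Function.comp_apply, id]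
    split_ifs <;> omega

theorem mem_sh {s : ℤ} {l : ℕ} {M : Multiset (ℕ × ℤ)} {q : ℕ × ℤ} :
    q ∈ sh s l M ↔ (q.1, q.2 + if l < q.1 then s else 0) ∈ M := by
  unfold sh
  rw [Multiset.mem_map]
  constructor
  · rintro ⟨p, hp, rfl⟩
    simpa using hp
  · intro h
    exact ⟨_, h, by simp⟩

theorem pos_sh {s : ℤ} {l : ℕ} {M : Multiset (ℕ × ℤ)} (h : Pos M) : Pos (sh s l M) := by
  intro p hp
  exact h (p.1, p.2 + if l < p.1 then s else 0) (mem_sh.1 hp)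

theorem sh_congr {s : ℤ} {l l' : ℕ} {M : Multiset (ℕ × ℤ)}
    (h : ∀ p ∈ M, s = 0 ∨ (l < p.1 ↔ l' < p.1)) : sh s l M = sh s l' M := by
  apply Multiset.map_congr rfl
  intro p hp
  rcases h p hp with h | h
  · simp [h]
  · simp [h]

theorem sh_id {s : ℤ} {l : ℕ} {M : Multiset (ℕ × ℤ)}
    (h : ∀ p ∈ M, s = 0 ∨ p.1 ≤ l) : sh s l M = M := by
  unfold sh
  conv_rhs => rw [← Multiset.map_id M]
  apply Multiset.map_congr rfl
  intro p hp
  rcases h p hp with h | h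
  · simp [h]
  · simp [not_lt.2 h]

theorem pos_cons {p : ℕ × ℤ} {M : Multiset (ℕ × ℤ)} : Pos (p ::ₘ M) ↔ 0 < p.1 ∧ Pos M := by
  simp [Pos]

theorem pos_add {M N : Multiset (ℕ × ℤ)} : Pos (M + N) ↔ Pos M ∧ Pos N := by
  simp only [Pos, Multiset.mem_add]
  constructor
  · intro h; exact ⟨fun p hp => h p (Or.inl hp), fun p hp => h p (Or.inr hp)⟩
  · rintro ⟨h1, h2⟩ p (hp | hp)
    exacts [h1 p hp, h2 p hp]

/-! ### Sums over shapes -/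

/-- Sum of `φ` over the row lengths. -/
def ss (φ : ℕ → ℤ) (M : Multiset (ℕ × ℤ)) : ℤ := (M.map fun p => φ p.1).sum

theorem ss_zero (φ : ℕ → ℤ) : ss φ 0 = 0 := by simp [ss]
theorem ss_cons (φ : ℕ → ℤ) (p : ℕ × ℤ) (M : Multiset (ℕ × ℤ)) :
    ss φ (p ::ₘ M) = φ p.1 + ss φ M := by simp [ss]
theorem ss_add (φ : ℕ → ℤ) (M N : Multiset (ℕ × ℤ)) : ss φ (M + N) = ss φ M + ss φ N := by
  simp [ss]
theorem ss_sh (φ : ℕ → ℤ) (s : ℤ) (l : ℕ) (M : Multiset (ℕ × ℤ)) : ss φ (sh s l M) = ss φ M := by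
  simp [ss, sh, Multiset.map_map]
theorem ss_cl (φ : ℕ → ℤ) (h0 : φ 0 = 0) (M : Multiset (ℕ × ℤ)) : ss φ (cl M) = ss φ M := by
  induction M using Multiset.induction_on with
  | empty => simp [cl]
  | cons p M ih =>
    obtain ⟨l, x⟩ := p
    rcases Nat.eq_zero_or_pos l with rfl | hl
    · rw [cl_cons_zero, ss_cons, ih, h0]; simp
    · rw [cl_cons_pos hl, ss_cons, ss_cons, ih]
theorem ss_nonneg {φ : ℕ → ℤ} (h : ∀ i, 0 ≤ φ i) (M : Multiset (ℕ × ℤ)) : 0 ≤ ss φ M := by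
  apply Multiset.sum_nonneg
  intro x hx
  obtain ⟨p, _, rfl⟩ := Multiset.mem_map.1 hx
  exact h _
theorem ss_eq_zero {φ : ℕ → ℤ} (h : ∀ i, 0 ≤ φ i) {M : Multiset (ℕ × ℤ)} (h0 : ss φ M = 0) :
    ∀ p ∈ M, φ p.1 = 0 := by
  intro p hp
  obtain ⟨N, rfl⟩ := Multiset.exists_cons_of_mem hp
  rw [ss_cons] at h0
  have := ss_nonneg h N
  have := h p.1
  omega
theorem ss_eq_zero_of {φ : ℕ → ℤ} {M : Multiset (ℕ × ℤ)} (h : ∀ p ∈ M, φ p.1 = 0) :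
    ss φ M = 0 := by
  unfold ss
  rw [Multiset.map_congr rfl h]
  simp
theorem ss_sub (φ ψ : ℕ → ℤ) (M : Multiset (ℕ × ℤ)) :
    ss (fun i => φ i - ψ i) M = ss φ M - ss ψ M := by
  simp [ss]

set_option linter.unusedSectionVars false

/-! ### Vacancy numbers -/

/-- Finitely many nonempty partitions, all rows positive. -/
def Good (ν : RCraw I) : Prop := (∀ b, Pos (ν b)) ∧ {b | ν b ≠ 0}.Finite

/-- `min i j` as an integer function of `j`. -/
def mn (i : ℕ) : ℕ → ℤ := fun j => min (i : ℤ) (j : ℤ)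
/-- Indicator of `i < j`. -/
def gt (i : ℕ) : ℕ → ℤ := fun j => if i < j then 1 else 0

theorem mn_succ (i j : ℕ) : mn (i + 1) j = mn i j + gt i j := by
  unfold mn gt; split_ifs <;> push_cast <;> omega

theorem gt_nonneg (i j : ℕ) : 0 ≤ gt i j := by unfold gt; split_ifs <;> simp

/-- Contribution of the colors other than `a` at color `c`. -/
noncomputable def W (A : I → I → ℤ) (c a : I) (ν : RCraw I) (φ : ℕ → ℤ) : ℤ :=
  -∑ᶠ b, (if b = a then 0 else A c b) * ss φ (ν b)

theorem supp_fin {ν : RCraw I} (h : Good ν) (c : I → ℤ) (φ : ℕ → ℤ) :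
    (Function.support fun b => c b * ss φ (ν b)).Finite := by
  apply h.2.subset
  intro b hb
  simp only [Function.mem_support] at hb
  simp only [Set.mem_ofPred_eq]
  intro h0
  apply hb
  rw [h0, ss_zero, mul_zero]

theorem W_sub (A : I → I → ℤ) (c a : I) {ν : RCraw I} (h : Good ν) (φ ψ : ℕ → ℤ) :
    W A c a ν (fun i => φ i - ψ i) = W A c a ν φ - W A c a ν ψ := by
  unfold W
  have h1 := finsum_sub_distrib (supp_fin h (fun b => if b = a then 0 else A c b) φ)
    (supp_fin h (fun b => if b = a then 0 else A c b) ψ)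
  have h2 : (∑ᶠ b, (if b = a then 0 else A c b) * ss (fun i => φ i - ψ i) (ν b)) =
    ∑ᶠ b, ((if b = a then 0 else A c b) * ss φ (ν b) -
      (if b = a then 0 else A c b) * ss ψ (ν b)) := by
    apply finsum_congr
    intro b
    rw [ss_sub]; ring
  rw [h2, h1]; ring

theorem W_congr (A : I → I → ℤ) (c a : I) {ν ν' : RCraw I} (φ : ℕ → ℤ)
    (h : ∀ b, b ≠ a → ss φ (ν' b) = ss φ (ν b)) : W A c a ν' φ = W A c a ν φ := by
  unfold W
  congr 1
  apply finsum_congr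
  intro b
  by_cases hb : b = a
  · simp [hb]
  · rw [h b hb]

theorem W_nonneg {A : I → I → ℤ} (hA : IsBorcherdsCartan A) (a : I) (ν : RCraw I)
    {φ : ℕ → ℤ} (hφ : ∀ i, 0 ≤ φ i) : 0 ≤ W A a a ν φ := by
  unfold W
  rw [← finsum_neg_distrib]
  apply finsum_nonneg
  intro b
  by_cases hb : b = a
  · simp [hb]
  · rw [if_neg hb]
    have h1 := hA.offdiag a b (Ne.symm hb)
    have h2 := ss_nonneg hφ (ν b)
    nlinarith

theorem W_eq_zero {A : I → I → ℤ} (hA : IsBorcherdsCartan A) (a : I) {ν : RCraw I} (hg : Good ν)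
    {φ : ℕ → ℤ} (hφ : ∀ i, 0 ≤ φ i) (h0 : W A a a ν φ = 0) (b : I) (hb : b ≠ a) :
    A a b = 0 ∨ ∀ p ∈ ν b, φ p.1 = 0 := by
  by_cases hAb : A a b = 0
  · exact Or.inl hAb
  right
  have hn : ∀ b, 0 ≤ -((if b = a then 0 else A a b) * ss φ (ν b)) := by
    intro b
    by_cases hb : b = a
    · simp [hb]
    · rw [if_neg hb]
      have h1 := hA.offdiag a b (Ne.symm hb)
      have h2 := ss_nonneg hφ (ν b)
      nlinarith
  unfold W at h0
  rw [← finsum_neg_distrib] at h0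
  have h1 := single_le_finsum b (f := fun b => -((if b = a then 0 else A a b) * ss φ (ν b)))
    (by
      have := supp_fin hg (fun b => -(if b = a then 0 else A a b)) φ
      simp only [neg_mul] at this
      exact this) hn
  rw [h0] at h1
  have h2 := hn b
  simp only [if_neg hb] at h1 h2
  have h3 : A a b * ss φ (ν b) = 0 := by omega
  rcases mul_eq_zero.1 h3 with h3 | h3
  · exact absurd h3 hAb
  · exact ss_eq_zero hφ h3

theorem finsum_split (A : I → I → ℤ) (c a : I) {ν : RCraw I} (h : Good ν) (φ : ℕ → ℤ) :
    -∑ᶠ b, A c b * ss φ (ν b) = -A c a * ss φ (ν a) + W A c a ν φ := by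
  unfold W
  have h1 := finsum_add_distrib (supp_fin h (fun b => if b = a then 0 else A c b) φ)
    (supp_fin h (fun b => if b = a then A c b else 0) φ)
  have h2 : (∑ᶠ b, A c b * ss φ (ν b)) =
    ∑ᶠ b, ((if b = a then 0 else A c b) * ss φ (ν b) +
      (if b = a then A c b else 0) * ss φ (ν b)) := by
    apply finsum_congr
    intro b
    split_ifs <;> ring
  have h3 : ∑ᶠ b, (if b = a then A c b else 0) * ss φ (ν b) = A c a * ss φ (ν a) := by
    rw [finsum_eq_single _ a]
    · simp
    · intro b hb; simp [hb]
  rw [h2, h1, h3]; ring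

theorem vac_split (A : I → I → ℤ) (c a : I) {ν : RCraw I} (h : Good ν) (i : ℕ) :
    vac A ν c i = -A c a * ss (mn i) (ν a) + W A c a ν (mn i) :=
  finsum_split A c a h (mn i)

theorem pInf_split (A : I → I → ℤ) (c a : I) {ν : RCraw I} (h : Good ν) :
    pInf A ν c = -A c a * rcSize ν a + W A c a ν (fun j => (j : ℤ)) :=
  finsum_split A c a h (fun j => (j : ℤ))

theorem vac_zero (A : I → I → ℤ) (c : I) (ν : RCraw I) : vac A ν c 0 = 0 := by
  unfold vac
  have : ∀ b, A c b * ((ν b).map fun p => (min ((0 : ℕ) : ℤ) (p.1 : ℤ))).sum = 0 := by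
    intro b
    have h : (fun p : ℕ × ℤ => (min ((0 : ℕ) : ℤ) (p.1 : ℤ))) = fun _ => 0 := by
      funext p; simp
    rw [h]; simp
  rw [finsum_congr this]; simp

/-- The contribution of the neighbours to the slope of the vacancy numbers. -/
noncomputable def T (A : I → I → ℤ) (a : I) (ν : RCraw I) (i : ℕ) : ℤ := W A a a ν (gt i)

theorem vac_succ (A : I → I → ℤ) (a : I) {ν : RCraw I} (h : Good ν) (i : ℕ) :
    vac A ν a (i + 1) = vac A ν a i + (-A a a * ss (gt i) (ν a) + T A a ν i) := by
  rw [vac_split A a a h, vac_split A a a h]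
  have h1 : gt i = fun j => mn (i + 1) j - mn i j := by
    funext j; rw [mn_succ]; ring
  unfold T
  rw [h1, W_sub A a a h, ss_sub]; ring

theorem T_nonneg {A : I → I → ℤ} (hA : IsBorcherdsCartan A) (a : I) (ν : RCraw I) (i : ℕ) :
    0 ≤ T A a ν i := W_nonneg hA a ν (gt_nonneg i)

theorem gt_sub_nonneg {i j : ℕ} (hij : i ≤ j) (k : ℕ) : 0 ≤ gt i k - gt j k := by
  unfold gt; split_ifs <;> omega

theorem T_anti {A : I → I → ℤ} (hA : IsBorcherdsCartan A) (a : I) {ν : RCraw I} (h : Good ν)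
    {i j : ℕ} (hij : i ≤ j) : T A a ν j ≤ T A a ν i := by
  have := W_nonneg hA a ν (gt_sub_nonneg hij)
  rw [W_sub A a a h] at this
  unfold T; omega

theorem T_eq_sh {A : I → I → ℤ} (hA : IsBorcherdsCartan A) {a : I} {ν : RCraw I} (h : Good ν)
    {i j : ℕ} (hij : i ≤ j) (hT : T A a ν i ≤ T A a ν j) {b : I} (hb : b ≠ a) :
    ∀ p ∈ ν b, A b a = 0 ∨ (i < p.1 ↔ j < p.1) := by
  have h0 : W A a a ν (fun k => gt i k - gt j k) = 0 := by
    have := T_anti hA a h hij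
    rw [W_sub A a a h]; unfold T at *; omega
  intro p hp
  rcases W_eq_zero hA a h (gt_sub_nonneg hij) h0 b hb with h1 | h1
  · exact Or.inl ((hA.zero_iff a b).1 h1)
  · right
    have := h1 p hp
    unfold gt at this
    split_ifs at this <;> omega

theorem T_zero_sh {A : I → I → ℤ} (hA : IsBorcherdsCartan A) {a : I} {ν : RCraw I} (h : Good ν)
    {i : ℕ} (hT : T A a ν i = 0) {b : I} (hb : b ≠ a) :
    ∀ p ∈ ν b, A b a = 0 ∨ p.1 ≤ i := by
  intro p hp
  rcases W_eq_zero hA a h (gt_nonneg i) hT b hb with h1 | h1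
  · exact Or.inl ((hA.zero_iff a b).1 h1)
  · right
    have := h1 p hp
    unfold gt at this
    split_ifs at this <;> omega

theorem vac_change (A : I → I → ℤ) (c a : I) {ν ν' : RCraw I} (h : Good ν) (h' : Good ν')
    {i : ℕ} {d : ℤ} (ho : ∀ b, b ≠ a → ss (mn i) (ν' b) = ss (mn i) (ν b))
    (ha : ss (mn i) (ν' a) = ss (mn i) (ν a) + d) :
    vac A ν' c i = vac A ν c i - A c a * d := by
  rw [vac_split A c a h, vac_split A c a h', ha, W_congr A c a (mn i) ho]; ring

/-! ### Concavity -/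

theorem rightStrict {p : ℕ → ℤ} {u v : ℕ} {c : ℤ}
    (hc : ∀ i, u < i + 1 → i + 1 < v → c + 1 ≤ p (i + 1) ∨ p i + p (i + 2) ≤ 2 * p (i + 1))
    (hu : c ≤ p u) (hv : c + 1 ≤ p v) : ∀ i, u < i → i ≤ v → c + 1 ≤ p i := by
  by_contra hcon
  push Not at hcon
  have hex : ∃ i, u < i ∧ i ≤ v ∧ p i < c + 1 := hcon
  classical
  obtain ⟨h1, h2, h3⟩ := Nat.find_spec hex
  have hmin := fun m (hm : m < Nat.find hex) => Nat.find_min hex hm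
  generalize Nat.find hex = i at *
  obtain ⟨m, rfl⟩ : ∃ m, i = m + 1 := ⟨i - 1, by omega⟩
  have hstart : p (m + 1) ≤ p m := by
    by_cases hm : u = m
    · subst hm; omega
    · have := hmin m (by omega)
      push Not at this
      have := this (by omega) (by omega)
      omega
  have hprop : ∀ k, m + k + 1 ≤ v → p (m + k + 1) ≤ p (m + k) ∧ p (m + k + 1) < c + 1 := by
    intro k
    induction k with
    | zero => intro _; exact ⟨hstart, h3⟩
    | succ k ih =>
      intro hk
      obtain ⟨i1, i2⟩ := ih (by omega)
      have := hc (m + k) (by omega) (by omega)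
      have e1 : m + (k + 1) + 1 = m + k + 2 := by ring
      have e2 : m + (k + 1) = m + k + 1 := by ring
      rw [e1, e2]
      omega
  have := (hprop (v - m - 1) (by omega)).2
  have e : m + (v - m - 1) + 1 = v := by omega
  rw [e] at this
  omega

theorem leftStrict {p : ℕ → ℤ} {u v : ℕ} {c : ℤ}
    (hc : ∀ i, u < i + 1 → i + 1 < v → c + 1 ≤ p (i + 1) ∨ p i + p (i + 2) ≤ 2 * p (i + 1))
    (hu : c + 1 ≤ p u) (hv : c ≤ p v) : ∀ i, u ≤ i → i < v → c + 1 ≤ p i := by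
  intro i hi hiv
  have := rightStrict (p := fun k => p (v - k)) (u := 0) (v := v - u) (c := c) ?_ ?_ ?_ (v - i)
    (by omega) (by omega)
  · have e : v - (v - i) = i := by omega
    simpa only [e] using this
  · intro j h1 h2
    have := hc (v - (j + 2)) (by omega) (by omega)
    have e1 : v - (j + 2) + 1 = v - (j + 1) := by omega
    have e2 : v - (j + 2) + 2 = v - j := by omega
    rw [e1, e2] at this
    omega
  · simpa using hv
  · have e : v - (v - u) = u := by omega
    simp only [e]; exact hu

/-! ### Specifications of the operators -/

theorem mem_cl_cons {l : ℕ} {x : ℤ} {N : Multiset (ℕ × ℤ)} {p : ℕ × ℤ}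
    (hp : p ∈ cl ((l, x) ::ₘ N)) : (p = (l, x) ∧ 0 < l) ∨ p ∈ N := by
  obtain ⟨h1, h2⟩ := mem_cl.1 hp
  rcases Multiset.mem_cons.1 h1 with rfl | h1
  · exact Or.inl ⟨rfl, h2⟩
  · exact Or.inr h1

theorem mem_cl_of_mem {l : ℕ} {x : ℤ} {N : Multiset (ℕ × ℤ)} {p : ℕ × ℤ} (hN : Pos N)
    (hp : p ∈ N) : p ∈ cl ((l, x) ::ₘ N) :=
  mem_cl.2 ⟨Multiset.mem_cons_of_mem hp, hN p hp⟩

theorem mem_cl_head {l : ℕ} {x : ℤ} {N : Multiset (ℕ × ℤ)} (hl : 0 < l) :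
    (l, x) ∈ cl ((l, x) ::ₘ N) :=
  mem_cl.2 ⟨Multiset.mem_cons_self _ _, hl⟩

theorem erase_cl {l : ℕ} {x : ℤ} {N : Multiset (ℕ × ℤ)} (hN : Pos N) :
    (cl ((l, x) ::ₘ N)).erase (l, x) = N := by
  rcases Nat.eq_zero_or_pos l with rfl | hl
  · rw [cl_cons_zero, cl_eq hN, Multiset.erase_of_notMem]
    intro h
    exact absurd (hN _ h) (by simp)
  · rw [cl_cons_pos hl, cl_eq hN, Multiset.erase_cons_head]

theorem sel {M : Multiset (ℕ × ℤ)} (hM : Pos M) (v : ℕ × ℤ → ℤ) :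
    ∃ (N : Multiset (ℕ × ℤ)) (l : ℕ) (r x : ℤ), M = cl ((l, r) ::ₘ N) ∧ (l ≠ 0 → v (l, r) = x) ∧
      (l = 0 → x = 0) ∧ Pos N ∧ x ≤ 0 ∧ ∀ p ∈ N, x ≤ v p ∧ (v p = x → p.1 ≤ l) := by
  obtain ⟨a1, a2, a3⟩ := fold_min_props (M.map v) 0
  generalize (M.map v).fold min 0 = x at *
  have a2' : ∀ p ∈ M, x ≤ v p := fun p hp => a2 _ (Multiset.mem_map_of_mem v hp)
  obtain ⟨b1, b2, b3⟩ := fold_max_propsN ((M.filter fun p => v p = x).map Prod.fst) 0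
  generalize ((M.filter fun p => v p = x).map Prod.fst).fold max 0 = l at *
  have b2' : ∀ p ∈ M, v p = x → p.1 ≤ l := fun p hp h =>
    b2 _ (Multiset.mem_map_of_mem Prod.fst (Multiset.mem_filter.2 ⟨hp, h⟩))
  rcases b3 with b3 | b3
  · subst b3
    refine ⟨M, 0, 0, x, ?_, by simp, ?_, hM, a1, fun p hp => ⟨a2' p hp, b2' p hp⟩⟩
    · rw [cl_cons_zero, cl_eq hM]
    · intro _
      rcases a3 with a3 | a3
      · exact a3
      · obtain ⟨p, hp, hx⟩ := Multiset.mem_map.1 a3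
        have := b2' p hp hx
        have := hM p hp
        omega
  · obtain ⟨⟨l', r⟩, hp, hl⟩ := Multiset.mem_map.1 b3
    obtain ⟨hp, hv⟩ := Multiset.mem_filter.1 hp
    simp only at hl
    subst hl
    obtain ⟨N, rfl⟩ := Multiset.exists_cons_of_mem hp
    obtain ⟨hl, hN⟩ := pos_cons.1 hM
    simp only at hl
    refine ⟨N, l', r, x, ?_, fun _ => hv, fun h => by omega, hN, a1, fun p hp =>
      ⟨a2' p (Multiset.mem_cons_of_mem hp), b2' p (Multiset.mem_cons_of_mem hp)⟩⟩
    rw [cl_cons_pos hl, cl_eq hN]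

/-- `f_a` acts on the row `(l, x)`; `N` are the other rows. -/
structure FSpec (a : I) (ν : RCraw I) (N : Multiset (ℕ × ℤ)) (l : ℕ) (x : ℤ) : Prop where
  eq : ν a = cl ((l, x) ::ₘ N)
  z : l = 0 → x = 0
  pos : Pos N
  le : x ≤ 0
  mn : ∀ p ∈ N, x ≤ p.2 ∧ (p.2 = x → p.1 ≤ l)

/-- The result of `f_a`. -/
def FRes (A : I → I → ℤ) (a : I) (ν : RCraw I) (N : Multiset (ℕ × ℤ)) (l : ℕ) (x : ℤ) :
    RCraw I := fun b =>
  if b = a then (l + 1, x - A a a / 2) ::ₘ sh (A a a) l N else sh (A b a) l (ν b)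

theorem exists_FSpec (a : I) {ν : RCraw I} (h : Pos (ν a)) : ∃ N l x, FSpec a ν N l x := by
  obtain ⟨N, l, r, x, h1, h2, h3, h4, h5, h6⟩ := sel h (fun p => p.2)
  refine ⟨N, l, x, ⟨?_, h3, h4, h5, h6⟩⟩
  rw [h1]
  rcases Nat.eq_zero_or_pos l with rfl | hl
  · rw [cl_cons_zero, cl_cons_zero]
  · have h2 : r = x := h2 (by omega)
    rw [h2]

theorem fOp_eq (A : I → I → ℤ) {a : I} {ν : RCraw I} {N : Multiset (ℕ × ℤ)} {l : ℕ} {x : ℤ}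
    (h : FSpec a ν N l x) : fOp A a ν = FRes A a ν N l x := by
  obtain ⟨h1, h2, h3, h4, h5⟩ := h
  have hx : minWith0 ((ν a).map Prod.snd) = x := by
    apply minWith0_eq h4
    · intro z hz
      obtain ⟨p, hp, rfl⟩ := Multiset.mem_map.1 hz
      rw [h1] at hp
      rcases mem_cl_cons hp with ⟨rfl, _⟩ | hp
      · exact le_refl _
      · exact (h5 p hp).1
    · rcases Nat.eq_zero_or_pos l with hl | hl
      · exact Or.inl (h2 hl)
      · right
        rw [h1]
        exact Multiset.mem_map_of_mem Prod.snd (mem_cl_head hl)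
  have hl : maxWith0 (((ν a).filter fun p => p.2 = x).map Prod.fst) = l := by
    apply maxWith0_eq
    · intro z hz
      obtain ⟨p, hp, rfl⟩ := Multiset.mem_map.1 hz
      obtain ⟨hp, hpx⟩ := Multiset.mem_filter.1 hp
      rw [h1] at hp
      rcases mem_cl_cons hp with ⟨rfl, _⟩ | hp
      · exact le_refl _
      · exact (h5 p hp).2 hpx
    · rcases Nat.eq_zero_or_pos l with hl | hl
      · exact Or.inl hl
      · right
        rw [h1]
        exact Multiset.mem_map.2 ⟨(l, x), Multiset.mem_filter.2 ⟨mem_cl_head hl, rfl⟩, rfl⟩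
  funext b
  unfold fOp FRes
  simp only [hx, hl]
  by_cases hb : b = a
  · subst hb
    simp only [if_true]
    rw [add_comm, Multiset.singleton_add, h1, erase_cl h3]; rfl
  · simp only [if_neg hb]; rfl

/-- `f_a^*` acts on the row of length `l` and corigging `x`; `N` are the other rows. -/
structure GSpec (A : I → I → ℤ) (a : I) (ν : RCraw I) (N : Multiset (ℕ × ℤ)) (l : ℕ) (x : ℤ) :
    Prop where
  eq : ν a = cl ((l, vac A ν a l - x) ::ₘ N)
  z : l = 0 → x = 0
  pos : Pos N
  le : x ≤ 0
  mn : ∀ p ∈ N, x ≤ vac A ν a p.1 - p.2 ∧ (vac A ν a p.1 - p.2 = x → p.1 ≤ l)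

/-- The result of `f_a^*`. -/
noncomputable def GRes (A : I → I → ℤ) (a : I) (ν : RCraw I) (N : Multiset (ℕ × ℤ)) (l : ℕ)
    (x : ℤ) : RCraw I := fun b =>
  if b = a then (l + 1, (vac A ν a (l + 1) - A a a) - (x - A a a / 2)) ::ₘ N else ν b

theorem exists_GSpec (A : I → I → ℤ) (a : I) {ν : RCraw I} (h : Pos (ν a)) :
    ∃ N l x, GSpec A a ν N l x := by
  obtain ⟨N, l, r, x, h1, h2, h3, h4, h5, h6⟩ := sel h (fun p => vac A ν a p.1 - p.2)
  refine ⟨N, l, x, ⟨?_, h3, h4, h5, h6⟩⟩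
  rw [h1]
  rcases Nat.eq_zero_or_pos l with rfl | hl
  · rw [cl_cons_zero, cl_cons_zero]
  · have h2 : vac A ν a l - r = x := h2 (by omega)
    have : vac A ν a l - x = r := by omega
    rw [this]

theorem fStar_eq {A : I → I → ℤ} {a : I} {ν : RCraw I} {N : Multiset (ℕ × ℤ)} {l : ℕ} {x : ℤ}
    (h : GSpec A a ν N l x) : fStar A a ν = GRes A a ν N l x := by
  obtain ⟨h1, h2, h3, h4, h5⟩ := h
  have hx : minWith0 (corigs A ν a) = x := by
    apply minWith0_eq h4
    · intro z hz
      obtain ⟨p, hp, rfl⟩ := Multiset.mem_map.1 hz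
      rw [h1] at hp
      rcases mem_cl_cons hp with ⟨rfl, _⟩ | hp
      · simp
      · exact (h5 p hp).1
    · rcases Nat.eq_zero_or_pos l with hl | hl
      · exact Or.inl (h2 hl)
      · right
        unfold corigs
        rw [h1]
        refine Multiset.mem_map.2 ⟨_, mem_cl_head hl, ?_⟩
        simp
  have hl : maxWith0 (((ν a).filter fun p => vac A ν a p.1 - p.2 = x).map Prod.fst) = l := by
    apply maxWith0_eq
    · intro z hz
      obtain ⟨p, hp, rfl⟩ := Multiset.mem_map.1 hz
      obtain ⟨hp, hpx⟩ := Multiset.mem_filter.1 hp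
      rw [h1] at hp
      rcases mem_cl_cons hp with ⟨rfl, _⟩ | hp
      · exact le_refl _
      · exact (h5 p hp).2 hpx
    · rcases Nat.eq_zero_or_pos l with hl | hl
      · exact Or.inl hl
      · right
        refine Multiset.mem_map.2 ⟨(l, vac A ν a l - x), Multiset.mem_filter.2 ⟨?_, ?_⟩, rfl⟩
        · rw [h1]; exact mem_cl_head hl
        · simp
  funext b
  unfold fStar GRes
  simp only [hx, hl]
  by_cases hb : b = a
  · subst hb
    simp only [if_true]
    rw [add_comm, Multiset.singleton_add, h1]
    congr 1
    exact erase_cl h3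
  · simp only [if_neg hb]

/-- The rigging condition for `e_a` to act. -/
def EC (A : I → I → ℤ) (a : I) (y : ℤ) : Prop :=
  (A a a = 2 ∧ y < 0) ∨ (A a a ≠ 2 ∧ y = -A a a / 2)

/-- `e_a` acts on the row `(k+1, y)`; `N` are the other rows. -/
structure ESpec (A : I → I → ℤ) (a : I) (ν : RCraw I) (N : Multiset (ℕ × ℤ)) (k : ℕ) (y : ℤ) :
    Prop where
  eq : ν a = (k + 1, y) ::ₘ N
  c : EC A a y
  mn : ∀ p ∈ N, y ≤ p.2 ∧ (p.2 = y → k + 1 ≤ p.1)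

/-- The result of `e_a`. -/
def ERes (A : I → I → ℤ) (a : I) (ν : RCraw I) (N : Multiset (ℕ × ℤ)) (k : ℕ) (y : ℤ) :
    RCraw I := fun b =>
  if b = a then cl ((k, y + A a a / 2) ::ₘ sh (-A a a) k N) else sh (-A b a) k (ν b)

theorem adjE (M : Multiset (ℕ × ℤ)) (s : ℤ) (k : ℕ) :
    M.map (fun p => (p.1, p.2 + if k + 1 ≤ p.1 then s else 0)) = sh (-s) k M := by
  unfold sh
  apply Multiset.map_congr rfl
  intro p _
  ext
  · rfl
  · simp only [Nat.succ_le_iff]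
    split_ifs <;> omega

theorem eRemove_eq {A : I → I → ℤ} {a : I} {ν : RCraw I} {N : Multiset (ℕ × ℤ)} {k : ℕ} {y : ℤ}
    (hp : Pos (ν a)) (h : ESpec A a ν N k y) : eRemove A a ν y = ERes A a ν N k y := by
  obtain ⟨h1, h2, h3⟩ := h
  have hl : minPosRowsN (((ν a).filter fun p => p.2 = y).map Prod.fst) = k + 1 := by
    apply minPosRowsN_eq
    · refine Multiset.mem_map.2 ⟨(k + 1, y), Multiset.mem_filter.2 ⟨?_, rfl⟩, rfl⟩
      rw [h1]; exact Multiset.mem_cons_self _ _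
    · intro z hz
      obtain ⟨p, hp, rfl⟩ := Multiset.mem_map.1 hz
      obtain ⟨hp, hpx⟩ := Multiset.mem_filter.1 hp
      rw [h1] at hp
      rcases Multiset.mem_cons.1 hp with rfl | hp
      · exact le_refl _
      · exact (h3 p hp).2 hpx
  rw [h1] at hp
  have hN := (pos_cons.1 hp).2
  funext b
  unfold eRemove ERes
  simp only [hl, adjE]
  by_cases hb : b = a
  · subst hb
    simp only [if_true]
    rw [h1, Multiset.erase_cons_head]
    rcases Nat.eq_zero_or_pos k with rfl | hk
    · rw [if_pos (by rfl), cl_cons_zero, cl_eq (pos_sh hN), add_zero]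
    · rw [if_neg (by omega), cl_cons_pos hk, cl_eq (pos_sh hN), add_comm, Multiset.singleton_add]
      simp
  · simp only [if_neg hb]

theorem eOp_eq {A : I → I → ℤ} {a : I} {ν : RCraw I} {N : Multiset (ℕ × ℤ)} {k : ℕ} {y : ℤ}
    (hp : Pos (ν a)) (h : ESpec A a ν N k y) : eOp A a ν = some (ERes A a ν N k y) := by
  rw [← eRemove_eq hp h]
  obtain ⟨h1, h2, h3⟩ := h
  unfold eOp
  have hall : ∀ z ∈ (ν a).map Prod.snd, y ≤ z := by
    intro z hz
    obtain ⟨p, hp, rfl⟩ := Multiset.mem_map.1 hz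
    rw [h1] at hp
    rcases Multiset.mem_cons.1 hp with rfl | hp
    · exact le_refl _
    · exact (h3 p hp).1
  have hmem : y ∈ (ν a).map Prod.snd := by
    rw [h1]; simp
  rcases h2 with ⟨h2, h4⟩ | ⟨h2, h4⟩
  · rw [if_pos h2]
    have hx : minWith0 ((ν a).map Prod.snd) = y := minWith0_eq h4.le hall (Or.inr hmem)
    simp only [hx]
    rw [if_neg (by omega)]
  · rw [if_neg h2]
    have hx : minPosRows ((ν a).map Prod.snd) = y := minPosRows_eq hmem hall
    rw [hx, if_neg, ← h4]
    rintro (h | h)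
    · rw [h1] at h; simp at h
    · exact h h4

theorem exists_minrow {M : Multiset (ℕ × ℤ)} (hM : Pos M) {v : ℕ × ℤ → ℤ} {y : ℤ}
    (h : y ∈ M.map v) :
    ∃ N k r, M = (k + 1, r) ::ₘ N ∧ v (k + 1, r) = y ∧ ∀ p ∈ N, v p = y → k + 1 ≤ p.1 := by
  have hs : (M.filter fun p => v p = y).map Prod.fst ≠ 0 := by
    obtain ⟨p, hp, hy⟩ := Multiset.mem_map.1 h
    intro h0
    have : p.1 ∈ (M.filter fun p => v p = y).map Prod.fst :=
      Multiset.mem_map_of_mem _ (Multiset.mem_filter.2 ⟨hp, hy⟩)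
    rw [h0] at this
    simp at this
  obtain ⟨h1, h2⟩ := minPosRowsN_spec hs
  generalize minPosRowsN ((M.filter fun p => v p = y).map Prod.fst) = l at *
  obtain ⟨⟨l', r⟩, hp, hl⟩ := Multiset.mem_map.1 h1
  obtain ⟨hp, hv⟩ := Multiset.mem_filter.1 hp
  simp only at hl
  subst hl
  have := hM _ hp
  obtain ⟨k, rfl⟩ : ∃ k, l' = k + 1 := ⟨l' - 1, by simp only at this; omega⟩
  obtain ⟨N, rfl⟩ := Multiset.exists_cons_of_mem hp
  refine ⟨N, k, r, rfl, hv, fun p hp h => h2 _ ?_⟩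
  exact Multiset.mem_map_of_mem _ (Multiset.mem_filter.2 ⟨Multiset.mem_cons_of_mem hp, h⟩)

theorem exists_ESpec {A : I → I → ℤ} {a : I} {ν : RCraw I} {y : ℤ} (hp : Pos (ν a))
    (hc : EC A a y) (h1 : ∀ p ∈ ν a, y ≤ p.2) (h2 : ∃ p ∈ ν a, p.2 = y) :
    ∃ N k, ESpec A a ν N k y := by
  obtain ⟨q, hq, hy⟩ := h2
  obtain ⟨N, k, r, h3, h4, h5⟩ := exists_minrow hp (v := Prod.snd) (y := y)
    (Multiset.mem_map.2 ⟨q, hq, hy⟩)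
  simp only at h4
  subst h4
  refine ⟨N, k, ⟨h3, hc, fun p hp => ⟨h1 p ?_, h5 p hp⟩⟩⟩
  rw [h3]; exact Multiset.mem_cons_of_mem hp

theorem eOp_some {A : I → I → ℤ} {a : I} {ν ν' : RCraw I} (hp : Pos (ν a))
    (h : eOp A a ν = some ν') : ∃ N k y, ESpec A a ν N k y ∧ ν' = ERes A a ν N k y := by
  suffices hs : ∃ y, EC A a y ∧ (∀ p ∈ ν a, y ≤ p.2) ∧ (∃ p ∈ ν a, p.2 = y) by
    obtain ⟨y, h1, h2, h3⟩ := hs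
    obtain ⟨N, k, hE⟩ := exists_ESpec hp h1 h2 h3
    refine ⟨N, k, y, hE, ?_⟩
    rw [eOp_eq hp hE] at h
    exact (Option.some.inj h).symm
  unfold eOp at h
  by_cases hA : A a a = 2
  · rw [if_pos hA] at h
    obtain ⟨a1, a2, a3⟩ := fold_min_props ((ν a).map Prod.snd) 0
    change minWith0 ((ν a).map Prod.snd) = 0 ∨ minWith0 _ ∈ _ at a3
    change minWith0 ((ν a).map Prod.snd) ≤ 0 at a1
    change ∀ z ∈ _, minWith0 ((ν a).map Prod.snd) ≤ z at a2
    simp only at h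
    generalize minWith0 ((ν a).map Prod.snd) = y at *
    by_cases hy : y = 0
    · rw [if_pos hy] at h; simp at h
    · refine ⟨y, Or.inl ⟨hA, by omega⟩, fun p hp => a2 _ (Multiset.mem_map_of_mem _ hp), ?_⟩
      exact Multiset.mem_map.1 (a3.resolve_left hy)
  · rw [if_neg hA] at h
    by_cases hc : ν a = 0 ∨ minPosRows ((ν a).map Prod.snd) ≠ -A a a / 2
    · rw [if_pos hc] at h; simp at h
    · push Not at hc
      have := minPosRows_spec (s := (ν a).map Prod.snd) (by simpa using hc.1)
      rw [hc.2] at this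
      refine ⟨_, Or.inr ⟨hA, rfl⟩, fun p hp => this.2 _ (Multiset.mem_map_of_mem _ hp), ?_⟩
      exact Multiset.mem_map.1 this.1

/-! ### Results are good, change of vacancy numbers -/

theorem good_of {ν ν' : RCraw I} (a : I) (h : Good ν) (hp : ∀ b, Pos (ν' b))
    (h0 : ∀ b, b ≠ a → ν b = 0 → ν' b = 0) : Good ν' := by
  refine ⟨hp, (h.2.union (Set.finite_singleton a)).subset ?_⟩
  intro b hb
  by_cases hba : b = a
  · right; exact hba
  · left; intro h1; exact hb (h0 b hba h1)

theorem sh_empty (s : ℤ) (l : ℕ) : sh s l 0 = 0 := by simp [sh]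

theorem good_F {A : I → I → ℤ} {a : I} {ν : RCraw I} {N : Multiset (ℕ × ℤ)} {l : ℕ} {x : ℤ}
    (h : Good ν) (hN : Pos N) : Good (FRes A a ν N l x) := by
  apply good_of a h
  · intro b
    unfold FRes
    by_cases hb : b = a
    · simp only [if_pos hb]; exact pos_cons.2 ⟨by simp, pos_sh hN⟩
    · simp only [if_neg hb]; exact pos_sh (h.1 b)
  · intro b hb h0
    unfold FRes
    simp only [if_neg hb, h0, sh_empty]

theorem good_G {A : I → I → ℤ} {a : I} {ν : RCraw I} {N : Multiset (ℕ × ℤ)} {l : ℕ} {x : ℤ}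
    (h : Good ν) (hN : Pos N) : Good (GRes A a ν N l x) := by
  apply good_of a h
  · intro b
    unfold GRes
    by_cases hb : b = a
    · simp only [if_pos hb]; exact pos_cons.2 ⟨by simp, hN⟩
    · simp only [if_neg hb]; exact (h.1 b)
  · intro b hb h0
    unfold GRes
    simp only [if_neg hb, h0]

theorem good_E {A : I → I → ℤ} {a : I} {ν : RCraw I} {N : Multiset (ℕ × ℤ)} {k : ℕ} {y : ℤ}
    (h : Good ν) : Good (ERes A a ν N k y) := by
  apply good_of a h
  · intro b
    unfold ERes
    by_cases hb : b = a
    · simp only [if_pos hb]; exact pos_cl _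
    · simp only [if_neg hb]; exact pos_sh (h.1 b)
  · intro b hb h0
    unfold ERes
    simp only [if_neg hb, h0, sh_empty]

theorem mn_zero (i : ℕ) : mn i 0 = 0 := by simp [mn]

theorem mn_right (i l : ℕ) : mn i (l + 1) = mn i l + if l < i then 1 else 0 := by
  unfold mn; split_ifs <;> push_cast <;> omega

theorem vac_F {A : I → I → ℤ} {a : I} {ν : RCraw I} {N : Multiset (ℕ × ℤ)} {l : ℕ} {x x' : ℤ}
    (h : Good ν) (hN : Pos N) (e : ν a = cl ((l, x') ::ₘ N)) (c : I) (i : ℕ) :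
    vac A (FRes A a ν N l x) c i = vac A ν c i - if l < i then A c a else 0 := by
  rw [vac_change A c a h (good_F h hN) (d := if l < i then 1 else 0)]
  · simp
  · intro b hb
    simp only [FRes, if_neg hb, ss_sh]
  · rw [e]
    simp only [FRes, if_true, ss_sh, ss_cons, ss_cl _ (mn_zero i), mn_right]
    ring

theorem vac_G {A : I → I → ℤ} {a : I} {ν : RCraw I} {N : Multiset (ℕ × ℤ)} {l : ℕ} {x x' : ℤ}
    (h : Good ν) (hN : Pos N) (e : ν a = cl ((l, x') ::ₘ N)) (c : I) (i : ℕ) :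
    vac A (GRes A a ν N l x) c i = vac A ν c i - if l < i then A c a else 0 := by
  rw [vac_change A c a h (good_G h hN) (d := if l < i then 1 else 0)]
  · simp
  · intro b hb
    simp only [GRes, if_neg hb]
  · rw [e]
    simp only [GRes, if_true, ss_cons, ss_cl _ (mn_zero i), mn_right]
    ring

theorem vac_E {A : I → I → ℤ} {a : I} {ν : RCraw I} {N : Multiset (ℕ × ℤ)} {k : ℕ} {y y' : ℤ}
    (h : Good ν) (e : ν a = (k + 1, y') ::ₘ N) (c : I) (i : ℕ) :
    vac A (ERes A a ν N k y) c i = vac A ν c i + if k < i then A c a else 0 := by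
  rw [vac_change A c a h (good_E h) (d := - if k < i then 1 else 0)]
  · split_ifs <;> simp
  · intro b hb
    simp only [ERes, if_neg hb, ss_sh]
  · rw [e]
    simp only [ERes, if_true, ss_cons, ss_cl _ (mn_zero i), mn_right, ss_sh]
    ring

theorem good_fOp {A : I → I → ℤ} (a : I) {ν : RCraw I} (h : Good ν) : Good (fOp A a ν) := by
  obtain ⟨N, l, x, hF⟩ := exists_FSpec a (h.1 a)
  rw [fOp_eq A hF]; exact good_F h hF.pos

theorem good_fStar {A : I → I → ℤ} (a : I) {ν : RCraw I} (h : Good ν) : Good (fStar A a ν) := by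
  obtain ⟨N, l, x, hF⟩ := exists_GSpec A a (h.1 a)
  rw [fStar_eq hF]; exact good_G h hF.pos

theorem good_empty : Good (emptyRC : RCraw I) := by
  refine ⟨?_, ?_⟩
  · intro b p hp; simp [emptyRC] at hp
  · simp [emptyRC]

/-! ### The involution exchanging riggings and coriggings -/

/-- Exchange riggings and coriggings. -/
noncomputable def th (A : I → I → ℤ) (ν : RCraw I) : RCraw I := fun b =>
  (ν b).map fun p => (p.1, vac A ν b p.1 - p.2)

theorem ss_th (A : I → I → ℤ) (ν : RCraw I) (φ : ℕ → ℤ) (b : I) :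
    ss φ (th A ν b) = ss φ (ν b) := by
  simp [ss, th, Multiset.map_map]

theorem vac_th (A : I → I → ℤ) (ν : RCraw I) (c : I) (i : ℕ) : vac A (th A ν) c i = vac A ν c i := by
  unfold vac
  congr 1
  apply finsum_congr
  intro b
  congr 1
  exact ss_th A ν (mn i) b

theorem th_th (A : I → I → ℤ) (ν : RCraw I) : th A (th A ν) = ν := by
  funext b
  show (th A ν b).map (fun p => (p.1, vac A (th A ν) b p.1 - p.2)) = ν b
  unfold th
  rw [Multiset.map_map]
  conv_rhs => rw [← Multiset.map_id (ν b)]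
  apply Multiset.map_congr rfl
  intro p _
  have := vac_th A ν b p.1
  unfold th at this
  simp [this]

theorem good_th {A : I → I → ℤ} {ν : RCraw I} (h : Good ν) : Good (th A ν) := by
  refine ⟨?_, h.2.subset ?_⟩
  · intro b p hp
    obtain ⟨q, hq, rfl⟩ := Multiset.mem_map.1 hp
    exact h.1 b q hq
  · intro b hb h0
    apply hb
    simp [th, h0]

theorem th_fOp (A : I → I → ℤ) (a : I) {ν : RCraw I} (h : Good ν) :
    th A (fOp A a ν) = fStar A a (th A ν) := by
  obtain ⟨N, l, x, hF⟩ := exists_FSpec a (h.1 a)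
  have hv := vac_F (A := A) (x := x) h hF.pos hF.eq
  have hpN : Pos (N.map fun p => (p.1, vac A ν a p.1 - p.2)) := by
    intro p hp
    obtain ⟨q, hq, rfl⟩ := Multiset.mem_map.1 hp
    exact hF.pos q hq
  have hG : GSpec A a (th A ν) (N.map fun p => (p.1, vac A ν a p.1 - p.2)) l x := by
    refine ⟨?_, hF.z, ?_, hF.le, ?_⟩
    · rw [vac_th]
      unfold th
      rw [hF.eq]
      rcases Nat.eq_zero_or_pos l with rfl | hl
      · rw [cl_cons_zero, cl_cons_zero, cl_eq hF.pos, cl_eq hpN]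
      · rw [cl_cons_pos hl, cl_cons_pos hl, cl_eq hF.pos, cl_eq hpN, Multiset.map_cons]
    · exact hpN
    · intro p hp
      obtain ⟨q, hq, rfl⟩ := Multiset.mem_map.1 hp
      have := hF.mn q hq
      simp only [vac_th, sub_sub_cancel]
      exact this
  rw [fStar_eq hG, fOp_eq A hF]
  funext b
  by_cases hb : b = a
  · subst hb
    simp only [th, hv]
    simp only [FRes, GRes, if_true, Multiset.map_cons, vac_th]
    congr 1
    · ext
      · rfl
      · simp
    · unfold sh
      rw [Multiset.map_map]
      apply Multiset.map_congr rfl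
      intro p _
      simp
  · simp only [th, hv]
    simp only [FRes, GRes, if_neg hb]
    unfold sh
    rw [Multiset.map_map]
    apply Multiset.map_congr rfl
    intro p _
    simp

theorem th_fStar (A : I → I → ℤ) (a : I) {ν : RCraw I} (h : Good ν) :
    th A (fStar A a ν) = fOp A a (th A ν) := by
  have := th_fOp A a (good_th (A := A) h)
  rw [th_th] at this
  rw [← this, th_th]

/-! ### Commutation for different colors -/

theorem C1f {A : I → I → ℤ} {a b : I} (hab : a ≠ b) {ν : RCraw I} (h : Good ν) :
    fOp A a (fStar A b ν) = fStar A b (fOp A a ν) := by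
  obtain ⟨N, l, x, hF⟩ := exists_FSpec a (h.1 a)
  obtain ⟨N2, l2, x2, hG⟩ := exists_GSpec A b (h.1 b)
  have hv := vac_F (A := A) (x := x) h hF.pos hF.eq
  have hF' : FSpec a (GRes A b ν N2 l2 x2) N l x := by
    refine ⟨?_, hF.z, hF.pos, hF.le, hF.mn⟩
    simp only [GRes, if_neg hab]; exact hF.eq
  have hG' : GSpec A b (FRes A a ν N l x) (sh (A b a) l N2) l2 x2 := by
    refine ⟨?_, hG.z, pos_sh hG.pos, hG.le, ?_⟩
    · rw [hv]
      simp only [FRes, if_neg hab.symm]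
      rw [hG.eq, sh_cl, sh_cons]
      simp only
      congr 3
      omega
    · intro p hp
      have := hG.mn _ (mem_sh.1 hp)
      rw [hv]
      simp only at this
      constructor
      · omega
      · intro h; apply this.2; omega
  rw [fOp_eq A hF, fStar_eq hG, fOp_eq A hF', fStar_eq hG']
  funext c
  by_cases hca : c = a
  · subst hca
    simp only [FRes, GRes, if_true, if_neg hab]
  · by_cases hcb : c = b
    · subst hcb
      simp only [GRes, if_true, hv]
      simp only [FRes, GRes, if_neg hca, if_true, sh_cons]
      congr 2
      omega
    · simp only [FRes, GRes, if_neg hca, if_neg hcb]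

theorem C1e {A : I → I → ℤ} {a b : I} (hab : a ≠ b) {ν ν'' : RCraw I} (h : Good ν)
    (he : eOp A a (fStar A b ν) = some ν'') :
    ∃ ν1, eOp A a ν = some ν1 ∧ ν'' = fStar A b ν1 := by
  obtain ⟨N2, l2, x2, hG⟩ := exists_GSpec A b (h.1 b)
  obtain ⟨N, k, y, hE', rfl⟩ := eOp_some ((good_fStar b h).1 a) he
  rw [fStar_eq hG] at hE' ⊢
  have hE : ESpec A a ν N k y := by
    refine ⟨?_, hE'.c, hE'.mn⟩
    have := hE'.eq
    simp only [GRes, if_neg hab] at this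
    exact this
  refine ⟨_, eOp_eq (h.1 a) hE, ?_⟩
  have hv := vac_E (A := A) (y := y) h hE.eq
  have hG' : GSpec A b (ERes A a ν N k y) (sh (-A b a) k N2) l2 x2 := by
    refine ⟨?_, hG.z, pos_sh hG.pos, hG.le, ?_⟩
    · rw [hv]
      simp only [ERes, if_neg hab.symm]
      rw [hG.eq, sh_cl, sh_cons]
      simp only
      congr 3
      split_ifs <;> omega
    · intro p hp
      have := hG.mn _ (mem_sh.1 hp)
      rw [hv]
      simp only at this
      constructor
      · split_ifs at * <;> omega
      · intro h; apply this.2; split_ifs at * <;> omega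
  rw [fStar_eq hG']
  funext c
  by_cases hca : c = a
  · subst hca
    simp only [ERes, GRes, if_true, if_neg hab]
  · by_cases hcb : c = b
    · subst hcb
      simp only [GRes, if_true, hv]
      simp only [ERes, GRes, if_neg hca, if_true, sh_cons]
      congr 2
      split_ifs <;> omega
    · simp only [ERes, GRes, if_neg hca, if_neg hcb]

/-! ### Commutation for the same color, generic position -/

theorem cl_cons_cl (p : ℕ × ℤ) (M : Multiset (ℕ × ℤ)) : cl (p ::ₘ cl M) = cl (p ::ₘ M) := by
  rw [cl_cons, cl_cons, cl_cl]

theorem commE {A : I → I → ℤ} {a : I} {μ : RCraw I} {N : Multiset (ℕ × ℤ)} {k l : ℕ} {x y R : ℤ}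
    (hg : Good μ) (hG : GSpec A a μ ((k + 1, y) ::ₘ N) l x) (hc : EC A a y)
    (hN : ∀ p ∈ N, y ≤ p.2 ∧ (p.2 = y → k + 1 ≤ p.1))
    (hl : 0 < l → y ≤ vac A μ a l - x ∧ (vac A μ a l - x = y → k + 1 ≤ l))
    (hR : R = (vac A μ a (l + 1) - A a a) - (x - A a a / 2))
    (hr : y ≤ R ∧ (R = y → k ≤ l))
    (hk : 0 < k → x ≤ vac A μ a k - (y + A a a / 2) ∧ (vac A μ a k - (y + A a a / 2) = x → k ≤ l)) :
    ∃ N1 N2, ESpec A a μ N1 k y ∧ ESpec A a (fStar A a μ) N2 k y ∧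
      ERes A a (fStar A a μ) N2 k y = fStar A a (ERes A a μ N1 k y) := by
  have hpN := (pos_cons.1 hG.pos).2
  have hE : ESpec A a μ (cl ((l, vac A μ a l - x) ::ₘ N)) k y := by
    refine ⟨?_, hc, ?_⟩
    · rw [hG.eq, Multiset.cons_swap, cl_cons_pos (by simp)]
    · intro p hp
      rcases mem_cl_cons hp with ⟨rfl, h0⟩ | hp
      · exact hl h0
      · exact hN p hp
  have hv := vac_E (A := A) (y := y) hg hE.eq
  have hE' : ESpec A a (fStar A a μ) ((l + 1, R) ::ₘ N) k y := by
    refine ⟨?_, hc, ?_⟩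
    · rw [fStar_eq hG]
      simp only [GRes, if_true, hR]
      rw [Multiset.cons_swap]
    · intro p hp
      rcases Multiset.mem_cons.1 hp with rfl | hp
      · exact ⟨hr.1, fun h => by have := hr.2 h; simp only; omega⟩
      · exact hN p hp
  refine ⟨_, _, hE, hE', ?_⟩
  have hG' : GSpec A a (ERes A a μ (cl ((l, vac A μ a l - x) ::ₘ N)) k y)
      (cl ((k, y + A a a / 2) ::ₘ sh (-A a a) k N)) l x := by
    refine ⟨?_, hG.z, pos_cl _, hG.le, ?_⟩
    · rw [hv]
      simp only [ERes, if_true]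
      rw [sh_cl, sh_cons, cl_cons_cl, cl_cons_cl, Multiset.cons_swap]
      congr 3
      simp only
      split_ifs <;> omega
    · intro p hp
      rw [hv]
      rcases mem_cl_cons hp with ⟨rfl, h0⟩ | hp
      · simpa using hk h0
      · have := hG.mn _ (Multiset.mem_cons_of_mem (mem_sh.1 hp))
        simp only at this
        constructor
        · split_ifs at * <;> omega
        · intro h; apply this.2; split_ifs at * <;> omega
  rw [fStar_eq hG', fStar_eq hG]
  funext c
  by_cases hca : c = a
  · subst hca
    simp only [GRes, if_true, hv]
    simp only [ERes, if_true]
    rw [sh_cons, Multiset.cons_swap, cl_cons_pos (by simp), hR]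
    congr 2
    simp only
    split_ifs <;> omega
  · simp only [ERes, GRes, if_neg hca]

theorem commF {A : I → I → ℤ} {a : I} {μ : RCraw I} {N : Multiset (ℕ × ℤ)} {k l : ℕ} {x y R : ℤ}
    (hg : Good μ) (hM : μ a = cl ((k, y) ::ₘ (l, vac A μ a l - x) ::ₘ N)) (hpN : Pos N)
    (hk0 : k = 0 → y = 0) (hl0 : l = 0 → x = 0) (hy : y ≤ 0) (hx : x ≤ 0)
    (hN : ∀ p ∈ N, y ≤ p.2 ∧ (p.2 = y → p.1 ≤ k))
    (hN' : ∀ p ∈ N, x ≤ vac A μ a p.1 - p.2 ∧ (vac A μ a p.1 - p.2 = x → p.1 ≤ l))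
    (hl : 0 < l → y ≤ vac A μ a l - x ∧ (vac A μ a l - x = y → l ≤ k))
    (hk : 0 < k → x ≤ vac A μ a k - y ∧ (vac A μ a k - y = x → k ≤ l))
    (hR : R = (vac A μ a (l + 1) - A a a) - (x - A a a / 2))
    (hr : y ≤ R ∧ (R = y → l + 1 ≤ k))
    (hr' : x ≤ (vac A μ a (k + 1) - A a a) - (y - A a a / 2) ∧
      ((vac A μ a (k + 1) - A a a) - (y - A a a / 2) = x → k + 1 ≤ l)) :
    fOp A a (fStar A a μ) = fStar A a (fOp A a μ) := by
  have hF : FSpec a μ (cl ((l, vac A μ a l - x) ::ₘ N)) k y := by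
    refine ⟨?_, hk0, pos_cl _, hy, ?_⟩
    · rw [hM, cl_cons_cl]
    · intro p hp
      rcases mem_cl_cons hp with ⟨rfl, h0⟩ | hp
      · exact hl h0
      · exact hN p hp
  have hG : GSpec A a μ (cl ((k, y) ::ₘ N)) l x := by
    refine ⟨?_, hl0, pos_cl _, hx, ?_⟩
    · rw [hM, cl_cons_cl, Multiset.cons_swap]
    · intro p hp
      rcases mem_cl_cons hp with ⟨rfl, h0⟩ | hp
      · exact hk h0
      · exact hN' p hp
  have hv := vac_F (A := A) (x := y) hg hF.pos hF.eq
  have hF' : FSpec a (fStar A a μ) ((l + 1, R) ::ₘ N) k y := by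
    refine ⟨?_, hk0, pos_cons.2 ⟨by simp, hpN⟩, hy, ?_⟩
    · rw [fStar_eq hG]
      simp only [GRes, if_true]
      rw [Multiset.cons_swap, cl_cons_pos (Nat.succ_pos l), hR]
    · intro p hp
      rcases Multiset.mem_cons.1 hp with rfl | hp
      · exact hr
      · exact hN p hp
  have hG' : GSpec A a (fOp A a μ) ((k + 1, y - A a a / 2) ::ₘ sh (A a a) k N) l x := by
    rw [fOp_eq A hF]
    refine ⟨?_, hl0, pos_cons.2 ⟨by simp, pos_sh hpN⟩, hx, ?_⟩
    · rw [hv]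
      simp only [FRes, if_true]
      rw [sh_cl, sh_cons, Multiset.cons_swap, cl_cons_pos (Nat.succ_pos k)]
      congr 4
      simp only
      split_ifs <;> omega
    · intro p hp
      rw [hv]
      rcases Multiset.mem_cons.1 hp with rfl | hp
      · simpa using hr'
      · have := hN' _ (mem_sh.1 hp)
        simp only at this
        constructor
        · omega
        · intro h; apply this.2; omega
  rw [fOp_eq A hF', fStar_eq hG', fOp_eq A hF, fStar_eq hG]
  funext c
  by_cases hca : c = a
  · subst hca
    simp only [GRes, if_true, hv]
    simp only [FRes, if_true]
    rw [sh_cons, Multiset.cons_swap, hR]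
    congr 2
    simp only
    split_ifs <;> omega
  · simp only [FRes, GRes, if_neg hca]

/-! ### `e` and `f` are inverse -/

theorem sh_neg_sh (s : ℤ) (l : ℕ) (M : Multiset (ℕ × ℤ)) : sh (-s) l (sh s l M) = M := by
  have := sh_sh_neg (-s) l M
  rwa [neg_neg] at this

theorem ERes_FRes {A : I → I → ℤ} {a : I} {ν : RCraw I} {N : Multiset (ℕ × ℤ)} {l : ℕ} {x : ℤ}
    (h : FSpec a ν N l x) :
    ERes A a (FRes A a ν N l x) (sh (A a a) l N) l (x - A a a / 2) = ν := by
  funext c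
  by_cases hca : c = a
  · subst hca
    simp only [ERes, if_true, sh_neg_sh]
    rw [h.eq]
    congr 2
    ext <;> simp
  · simp only [ERes, FRes, if_neg hca, sh_neg_sh]

theorem EF {A : I → I → ℤ} {a : I} {ν : RCraw I} {N : Multiset (ℕ × ℤ)} {l : ℕ} {x : ℤ}
    (hA : A a a = 2) (h : FSpec a ν N l x) :
    ESpec A a (FRes A a ν N l x) (sh (A a a) l N) l (x - A a a / 2) := by
  refine ⟨by simp [FRes], Or.inl ⟨hA, ?_⟩, ?_⟩
  · have := h.le; rw [hA]; omega
  · intro p hp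
    have := h.mn _ (mem_sh.1 hp)
    rw [hA] at *
    simp only at this
    obtain ⟨h1, h2⟩ := this
    split_ifs at * with h3
    · refine ⟨?_, fun _ => h3⟩
      by_contra hc
      have := h2 (by omega)
      omega
    · constructor
      · omega
      · intro h; omega

theorem FE {A : I → I → ℤ} {a : I} {ν : RCraw I} {N : Multiset (ℕ × ℤ)} {k : ℕ} {y : ℤ}
    (hA : A a a = 2) (hp : Pos (ν a)) (h : ESpec A a ν N k y) (hk : k = 0 → y = -1) :
    fOp A a (ERes A a ν N k y) = ν := by
  have hN : Pos N := by
    rw [h.eq] at hp; exact (pos_cons.1 hp).2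
  have hy : y < 0 := by
    rcases h.c with h1 | h1
    · exact h1.2
    · exact absurd hA h1.1
  have hF : FSpec a (ERes A a ν N k y) (sh (-A a a) k N) k (y + A a a / 2) := by
    refine ⟨by simp [ERes], ?_, pos_sh hN, ?_, ?_⟩
    · intro h0; rw [hk h0, hA]; rfl
    · rw [hA]; omega
    · intro p hp
      have := h.mn _ (mem_sh.1 hp)
      rw [hA] at *
      simp only at this
      obtain ⟨h1, h2⟩ := this
      split_ifs at * with h3
      · constructor
        · omega
        · intro h; omega
      · constructor
        · by_contra hc
          have := h2 (by omega)
          omega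
        · intro h; omega
  rw [fOp_eq A hF]
  funext c
  by_cases hca : c = a
  · subst hca
    simp only [FRes, if_true, sh_sh_neg]
    rw [h.eq]
    congr 2
    omega
  · simp only [ERes, FRes, if_neg hca, sh_sh_neg]

/-! ### Real colors -/

theorem ss_gt_eq {M : Multiset (ℕ × ℤ)} {i j : ℕ} (h : ∀ p ∈ M, i < p.1 ↔ j < p.1) :
    ss (gt i) M = ss (gt j) M := by
  unfold ss
  congr 1
  apply Multiset.map_congr rfl
  intro p hp
  unfold gt
  simp [h p hp]

theorem vac_conc {A : I → I → ℤ} (hA : IsBorcherdsCartan A) (a : I) {μ : RCraw I} (hg : Good μ)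
    {i : ℕ} (h : ∀ p ∈ μ a, p.1 ≠ i + 1) :
    vac A μ a i + vac A μ a (i + 2) ≤ 2 * vac A μ a (i + 1) := by
  have h1 := vac_succ A a hg i
  have h2 := vac_succ A a hg (i + 1)
  have h3 := T_anti hA a hg (Nat.le_succ i)
  rw [ss_gt_eq (i := i + 1) (j := i) (fun p hp => by have := h p hp; omega)] at h2
  simp only [Nat.succ_eq_add_one] at h3
  have e : i + 2 = i + 1 + 1 := rfl
  rw [e, h2, h1]
  omega

theorem conc' {A : I → I → ℤ} (hA : IsBorcherdsCartan A) (a : I) {μ : RCraw I} (hg : Good μ)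
    {u v : ℕ} {c : ℤ} (h : ∀ p ∈ μ a, u < p.1 → p.1 < v → c + 1 ≤ vac A μ a p.1) :
    ∀ i, u < i + 1 → i + 1 < v → c + 1 ≤ vac A μ a (i + 1) ∨
      vac A μ a i + vac A μ a (i + 2) ≤ 2 * vac A μ a (i + 1) := by
  intro i h1 h2
  by_cases hi : ∃ p ∈ μ a, p.1 = i + 1
  · obtain ⟨p, hp, hpi⟩ := hi
    left
    have := h p hp (by omega) (by omega)
    rwa [hpi] at this
  · right
    push Not at hi
    exact vac_conc hA a hg hi

theorem caseA {A : I → I → ℤ} (hA : IsBorcherdsCartan A) {a : I} (hA2 : A a a = 2) {μ : RCraw I}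
    (hg : Good μ) {N : Multiset (ℕ × ℤ)} {l : ℕ} {x y : ℤ} (hG : GSpec A a μ N l x)
    (hy : y ≤ 0) (hr : ∀ p ∈ μ a, y ≤ p.2) (hc : vac A μ a (l + 1) ≤ x + y) :
    fOp A a μ = fStar A a μ := by
  have hl : x + y ≤ vac A μ a l := by
    rcases Nat.eq_zero_or_pos l with rfl | hl
    · rw [vac_zero, hG.z rfl]; omega
    · have := hr (l, vac A μ a l - x) (by rw [hG.eq]; exact mem_cl_head hl)
      simp only at this
      omega
  have hrN : ∀ p ∈ N, y ≤ p.2 := fun p hp => hr p (by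
    rw [hG.eq]; exact mem_cl_of_mem hG.pos hp)
  have hbig : ∀ p ∈ μ a, l < p.1 → x + y + 1 ≤ vac A μ a p.1 := by
    intro p hp hlp
    rw [hG.eq] at hp
    rcases mem_cl_cons hp with ⟨rfl, h0⟩ | hp
    · simp at hlp
    · have h1 := hG.mn p hp
      have h2 := hrN p hp
      by_contra hcon
      have := h1.2 (by omega)
      omega
  have hno : ∀ p ∈ μ a, p.1 ≤ l := by
    intro p hp
    by_contra hcon
    push Not at hcon
    have := rightStrict (p := vac A μ a) (u := l) (v := p.1) (c := x + y)
      (conc' hA a hg (fun q hq h1 _ => hbig q hq h1)) hl (hbig p hp hcon) (l + 1) (by omega)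
      (by omega)
    omega
  have h1 := vac_succ A a hg l
  have hn : ss (gt l) (μ a) = 0 := by
    apply ss_eq_zero_of
    intro p hp
    have := hno p hp
    unfold gt
    rw [if_neg (by omega)]
  rw [hn] at h1
  have hT := T_nonneg hA a μ l
  have hT0 : T A a μ l = 0 := by omega
  have hPl : vac A μ a l = x + y := by omega
  have hNl : ∀ p ∈ N, p.1 ≤ l := fun p hp => hno p (by
    rw [hG.eq]; exact mem_cl_of_mem hG.pos hp)
  have hF : FSpec a μ N l y := by
    refine ⟨?_, ?_, hG.pos, hy, fun p hp => ⟨hrN p hp, fun _ => hNl p hp⟩⟩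
    · rw [hG.eq, hPl]; congr 3; omega
    · intro h0
      have := hG.z h0
      rw [h0, vac_zero] at hPl
      omega
  rw [fOp_eq A hF, fStar_eq hG]
  funext c
  by_cases hca : c = a
  · subst hca
    simp only [FRes, GRes, if_true]
    rw [sh_id (fun p hp => Or.inr (hNl p hp))]
    congr 2
    omega
  · simp only [FRes, GRes, if_neg hca]
    exact sh_id (T_zero_sh hA hg hT0 hca)

theorem L0 {A : I → I → ℤ} (hA : IsBorcherdsCartan A) {a : I} (hA2 : A a a = 2) {μ : RCraw I}
    (hg : Good μ) (hr : ∀ p ∈ μ a, 0 ≤ p.2) :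
    fOp A a μ = fStar A a μ ∨ ∀ p ∈ fStar A a μ a, 0 ≤ p.2 := by
  obtain ⟨N, l, x, hG⟩ := exists_GSpec A a (hg.1 a)
  by_cases hc : vac A μ a (l + 1) ≤ x + 0
  · exact Or.inl (caseA hA hA2 hg hG le_rfl hr hc)
  · right
    rw [fStar_eq hG]
    intro p hp
    simp only [GRes, if_true] at hp
    rcases Multiset.mem_cons.1 hp with rfl | hp
    · simp only; omega
    · exact hr p (by rw [hG.eq]; exact mem_cl_of_mem hG.pos hp)

theorem ec2 {A : I → I → ℤ} {a : I} (hA2 : A a a = 2) {y : ℤ} : EC A a y ↔ y < 0 := by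
  unfold EC
  constructor
  · rintro (h | h)
    · exact h.2
    · exact absurd hA2 h.1
  · intro h; exact Or.inl ⟨hA2, h⟩

/-- The conclusion of the main lemma for real colors. -/
def LC (A : I → I → ℤ) (a : I) (μ μ1 : RCraw I) (k : ℕ) (y : ℤ) : Prop :=
  ∃ N' k' y', ESpec A a (fStar A a μ) N' k' y' ∧
    ERes A a (fStar A a μ) N' k' y' = fStar A a μ1 ∧ ((k = 0 → y = -1) → (k' = 0 → y' = -1))

theorem Ldist {A : I → I → ℤ} (hA : IsBorcherdsCartan A) {a : I} (hA2 : A a a = 2) {μ : RCraw I}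
    (hg : Good μ) {N : Multiset (ℕ × ℤ)} {k l : ℕ} {x y : ℤ}
    (hG : GSpec A a μ ((k + 1, y) ::ₘ N) l x)
    (hE : ESpec A a μ (cl ((l, vac A μ a l - x) ::ₘ N)) k y)
    (hc : x + y + 1 ≤ vac A μ a (l + 1)) :
    LC A a μ (ERes A a μ (cl ((l, vac A μ a l - x) ::ₘ N)) k y) k y := by
  have hy := (ec2 hA2).1 hE.c
  have hpN := (pos_cons.1 hG.pos).2
  have hN : ∀ p ∈ N, y ≤ p.2 ∧ (p.2 = y → k + 1 ≤ p.1) := fun p hp =>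
    hE.mn p (mem_cl_of_mem hpN hp)
  have hl : 0 < l → y ≤ vac A μ a l - x ∧ (vac A μ a l - x = y → k + 1 ≤ l) := fun h0 =>
    hE.mn (l, vac A μ a l - x) (mem_cl_head h0)
  have hk1 : x ≤ vac A μ a (k + 1) - y ∧ (vac A μ a (k + 1) - y = x → k + 1 ≤ l) :=
    hG.mn (k + 1, y) (Multiset.mem_cons_self _ _)
  have hNc : ∀ p ∈ N, x ≤ vac A μ a p.1 - p.2 ∧ (vac A μ a p.1 - p.2 = x → p.1 ≤ l) :=
    fun p hp => hG.mn p (Multiset.mem_cons_of_mem hp)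
  have hx := hG.le
  -- classification of rows
  have hrow : ∀ p ∈ μ a, p = (k + 1, y) ∨ (p = (l, vac A μ a l - x) ∧ 0 < l) ∨ p ∈ N := by
    intro p hp
    rw [hE.eq] at hp
    rcases Multiset.mem_cons.1 hp with h | hp
    · exact Or.inl h
    · rcases mem_cl_cons hp with h | h
      · exact Or.inr (Or.inl h)
      · exact Or.inr (Or.inr h)
  have hlow : ∀ p ∈ μ a, p.1 < k + 1 → x + y + 1 ≤ vac A μ a p.1 := by
    intro p hp h1
    rcases hrow p hp with rfl | ⟨rfl, h0⟩ | hp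
    · simp at h1
    · have := hl h0
      simp only at h1 ⊢
      by_contra hcon
      have := this.2 (by omega)
      omega
    · have h2 := hN p hp
      have h3 := hNc p hp
      by_contra hcon
      have := h2.2 (by omega)
      omega
  have hmid : ∀ p ∈ μ a, l < p.1 → p.1 < k + 1 → x + y + 2 ≤ vac A μ a p.1 := by
    intro p hp h0 h1
    rcases hrow p hp with rfl | ⟨rfl, h0⟩ | hp
    · simp at h1
    · simp at h0
    · have h2 := hN p hp
      have h3 := hNc p hp
      by_contra hcon
      by_cases hpy : p.2 = y
      · have := h2.2 hpy; omega
      · have := h3.2 (by omega); omega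
  have hPk : x + y + 1 ≤ vac A μ a k := by
    refine leftStrict (p := vac A μ a) (u := 0) (v := k + 1) (c := x + y)
      (conc' hA a hg (fun q hq _ h1 => hlow q hq h1)) ?_ ?_ k (by omega) (by omega)
    · rw [vac_zero]; omega
    · omega
  by_cases hb : vac A μ a (l + 1) = x + y + 1 ∧ l < k
  · -- case (b)
    obtain ⟨hb1, hb2⟩ := hb
    have hPk1 : x + y + 1 ≤ vac A μ a (k + 1) := by
      by_contra hcon
      have := hk1.2 (by omega)
      omega
    have hPl : x + y + 1 ≤ vac A μ a l := by
      rcases Nat.eq_zero_or_pos l with rfl | h0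
      · rw [vac_zero]; omega
      · exact hlow (l, vac A μ a l - x) (by
          rw [hE.eq]; exact Multiset.mem_cons_of_mem (mem_cl_head h0)) (by simp only; omega)
    have hup : ∀ i, l + 1 < i → i ≤ k + 1 → vac A μ a i ≤ x + y + 1 := by
      intro i h1 h2
      by_contra hcon
      have := rightStrict (p := vac A μ a) (u := l) (v := i) (c := x + y + 1)
        (conc' hA a hg (fun q hq h3 h4 => by have := hmid q hq h3 (by omega); omega)) hPl
        (by omega) (l + 1) (by omega) (by omega)
      omega
    have hPl' : vac A μ a l = x + y + 1 := by
      by_contra hcon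
      have := leftStrict (p := vac A μ a) (u := l) (v := k + 1) (c := x + y + 1)
        (conc' hA a hg (fun q hq h3 h4 => by have := hmid q hq h3 (by omega); omega))
        (by omega) hPk1 (l + 1) (by omega) (by omega)
      omega
    have hPk1' : vac A μ a (k + 1) = x + y + 1 := by
      have := hup (k + 1) (by omega) le_rfl; omega
    have hPk' : vac A μ a k = x + y + 1 := by
      by_cases h : k = l + 1
      · rw [h]; exact hb1
      · have := hup k (by omega) (by omega); omega
    have hgap : ∀ p ∈ μ a, l < p.1 ↔ k < p.1 := by
      intro p hp
      constructor
      · intro h1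
        by_contra h2
        have h3 := hmid p hp h1 (by omega)
        by_cases h : p.1 = l + 1
        · rw [h] at h3; omega
        · have := hup p.1 (by omega) (by omega); omega
      · intro h; omega
    have hgapN : ∀ p ∈ N, l < p.1 ↔ k < p.1 := fun p hp => hgap p (by
      rw [hE.eq]; exact Multiset.mem_cons_of_mem (mem_cl_of_mem hpN hp))
    have hT : T A a μ l ≤ T A a μ k := by
      have h1 := vac_succ A a hg l
      have h2 := vac_succ A a hg k
      rw [ss_gt_eq hgap] at h1
      omega
    have hE' : ESpec A a (fStar A a μ) ((k + 1, y) ::ₘ N) l y := by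
      refine ⟨?_, hE.c, ?_⟩
      · rw [fStar_eq hG]
        simp only [GRes, if_true]
        congr 2
        omega
      · intro p hp
        rcases Multiset.mem_cons.1 hp with rfl | hp
        · exact ⟨le_rfl, fun _ => by simp only; omega⟩
        · exact ⟨(hN p hp).1, fun h => by have := (hN p hp).2 h; omega⟩
    have hv := vac_E (A := A) (y := y) hg hE.eq
    have hG' : GSpec A a (ERes A a μ (cl ((l, vac A μ a l - x) ::ₘ N)) k y)
        (cl ((l, y + 1) ::ₘ sh (-A a a) k N)) k x := by
      refine ⟨?_, fun h => by omega, pos_cl _, hx, ?_⟩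
      · rw [hv]
        simp only [ERes, if_true]
        rw [sh_cl, sh_cons, cl_cons_cl, cl_cons_cl, if_neg (lt_irrefl k)]
        simp only
        rw [if_neg (by omega), hPl', hPk', hA2]
        have e1 : x + y + 1 - x - 0 = y + 1 := by omega
        have e2 : x + y + 1 + 0 - x = y + 1 := by omega
        have e3 : y + 2 / 2 = y + 1 := by omega
        rw [e1, e2, e3]
      · intro p hp
        rw [hv]
        rcases mem_cl_cons hp with ⟨rfl, h0⟩ | hp
        · simp only
          rw [if_neg (by omega), hPl']
          exact ⟨by omega, fun _ => by omega⟩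
        · have := hNc _ (mem_sh.1 hp)
          simp only at this
          constructor
          · split_ifs at * <;> omega
          · intro h
            have := this.2 (by split_ifs at * <;> omega)
            omega
    refine ⟨_, _, _, hE', ?_, ?_⟩
    · rw [fStar_eq hG', fStar_eq hG]
      funext c
      by_cases hca : c = a
      · subst hca
        simp only [GRes, if_true, hv]
        simp only [ERes, if_true]
        rw [sh_cons, Multiset.cons_swap, cl_cons_pos (Nat.succ_pos k)]
        simp only
        rw [sh_congr (fun p hp => Or.inr (hgapN p hp)), hPk1', hA2, if_pos (by omega),
          if_pos (by omega)]
        congr 2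
        omega
      · simp only [ERes, GRes, if_neg hca]
        apply sh_congr
        intro p hp
        have := T_eq_sh hA hg hb2.le hT hca p hp
        rcases this with h | h
        · left; omega
        · right; exact h
    · intro _ h0
      have := hG.z h0
      rw [h0, vac_zero] at hPl'
      omega
  · -- case (a)
    obtain ⟨N1, N2, h1, h2, h3⟩ := commE (R := vac A μ a (l + 1) - A a a - (x - A a a / 2)) hg hG
      hE.c hN hl rfl
      ⟨by omega, fun h => by
        by_contra hlk
        exact hb ⟨by omega, by omega⟩⟩
      (fun _ => ⟨by omega, fun h => by
        by_contra hlk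
        have hPk1 : x + y + 1 ≤ vac A μ a (k + 1) := by
          by_contra hcon
          have := hk1.2 (by omega)
          omega
        have hne : vac A μ a (l + 1) ≠ x + y + 1 := fun h => hb ⟨h, by omega⟩
        have := leftStrict (p := vac A μ a) (u := l + 1) (v := k + 1) (c := x + y + 1)
          (conc' hA a hg (fun q hq h3 h4 => by have := hmid q hq (by omega) (by omega); omega))
          (by omega) hPk1 k (by omega) (by omega)
        omega⟩)
    refine ⟨_, _, _, h2, ?_, fun h => h⟩
    rw [h3]
    have e1 := eOp_eq (hg.1 a) h1
    have e2 := eOp_eq (hg.1 a) hE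
    rw [e1] at e2
    rw [Option.some.inj e2]

theorem Luniq {A : I → I → ℤ} (hA : IsBorcherdsCartan A) {a : I} (hA2 : A a a = 2) {μ : RCraw I}
    (hg : Good μ) {N : Multiset (ℕ × ℤ)} {k : ℕ} {x y : ℤ}
    (hG : GSpec A a μ N (k + 1) x) (hE : ESpec A a μ N k y)
    (hPl : vac A μ a (k + 1) = x + y) (hnm : (k + 1, y) ∉ N)
    (hc : x + y + 1 ≤ vac A μ a (k + 1 + 1)) :
    LC A a μ (ERes A a μ N k y) k y := by
  have hy := (ec2 hA2).1 hE.c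
  have hx := hG.le
  have hlow : ∀ p ∈ μ a, 0 < p.1 → p.1 < k + 1 → x + y + 1 ≤ vac A μ a p.1 := by
    intro p hp _ h1
    rw [hE.eq] at hp
    rcases Multiset.mem_cons.1 hp with rfl | hp
    · simp at h1
    · have h2 := hE.mn p hp
      have h3 := hG.mn p hp
      by_contra hcon
      have := h2.2 (by omega)
      omega
  have hPk : x + y + 1 ≤ vac A μ a k := by
    refine leftStrict (p := vac A μ a) (u := 0) (v := k + 1) (c := x + y)
      (conc' hA a hg hlow) ?_ ?_ k (by omega) (by omega)
    · rw [vac_zero]; omega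
    · omega
  have hlen : ∀ p ∈ N, p.1 ≠ k + 1 := by
    intro p hp h
    have h2 := hE.mn p hp
    have h3 := hG.mn p hp
    rw [h, hPl] at h3
    apply hnm
    have : p = (k + 1, y) := by
      ext
      · exact h
      · simp only; omega
    rwa [← this]
  have hgap : ∀ p ∈ N, k < p.1 ↔ k + 1 < p.1 := fun p hp => by have := hlen p hp; omega
  have h1 := vac_succ A a hg k
  have h2 := vac_succ A a hg (k + 1)
  have h3 := T_anti hA a hg (Nat.le_succ k)
  rw [hE.eq, ss_cons, ss_gt_eq hgap] at h1
  rw [hE.eq, ss_cons] at h2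
  have e1 : gt k (k + 1) = 1 := by simp [gt]
  have e2 : gt (k + 1) (k + 1) = 0 := by simp [gt]
  simp only [e1, hA2] at h1
  simp only [e2, hA2] at h2
  simp only [Nat.succ_eq_add_one] at h3
  have hT : T A a μ k ≤ T A a μ (k + 1) := by omega
  have hPk' : vac A μ a k = x + y + 1 := by omega
  have hPk2 : vac A μ a (k + 1 + 1) = x + y + 1 := by omega
  have hE' : ESpec A a (fStar A a μ) N (k + 1) y := by
    refine ⟨?_, hE.c, ?_⟩
    · rw [fStar_eq hG]
      simp only [GRes, if_true]
      congr 2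
      omega
    · intro p hp
      exact ⟨(hE.mn p hp).1, fun h => by
        have := (hE.mn p hp).2 h
        have := hlen p hp
        omega⟩
  have hv := vac_E (A := A) (y := y) hg hE.eq
  have hG' : GSpec A a (ERes A a μ N k y) (sh (-A a a) k N) k x := by
    refine ⟨?_, ?_, pos_sh hG.pos, hx, ?_⟩
    · rw [hv]
      simp only [ERes, if_true]
      rw [if_neg (lt_irrefl k), hPk', hA2]
      congr 3
      omega
    · intro h0
      rw [h0, vac_zero] at hPk'
      omega
    · intro p hp
      rw [hv]
      have := hG.mn _ (mem_sh.1 hp)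
      have h5 := hlen _ (mem_sh.1 hp)
      simp only at this h5
      constructor
      · split_ifs at * <;> omega
      · intro h
        have := this.2 (by split_ifs at * <;> omega)
        omega
  refine ⟨_, _, _, hE', ?_, fun _ h => by omega⟩
  rw [fStar_eq hG', fStar_eq hG]
  funext c
  by_cases hca : c = a
  · subst hca
    simp only [GRes, if_true, hv]
    simp only [ERes, if_true]
    rw [cl_cons_pos (Nat.succ_pos k), cl_eq (pos_sh hG.pos),
      sh_congr (fun p hp => Or.inr (hgap p hp)), hPl, hA2, if_pos (by omega)]
    congr 2
    omega
  · simp only [ERes, GRes, if_neg hca]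
    apply sh_congr
    intro p hp
    have := T_eq_sh hA hg (Nat.le_succ k) hT hca p hp
    rcases this with h | h
    · left; omega
    · right; exact h.symm

theorem L {A : I → I → ℤ} (hA : IsBorcherdsCartan A) {a : I} (hA2 : A a a = 2) {μ : RCraw I}
    (hg : Good μ) {N1 : Multiset (ℕ × ℤ)} {k : ℕ} {y : ℤ} (hE : ESpec A a μ N1 k y) :
    fOp A a μ = fStar A a μ ∨ LC A a μ (ERes A a μ N1 k y) k y := by
  obtain ⟨N2, l, x, hG⟩ := exists_GSpec A a (hg.1 a)
  have hy := (ec2 hA2).1 hE.c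
  have hpN1 : Pos N1 := by
    have := hg.1 a
    rw [hE.eq] at this; exact (pos_cons.1 this).2
  by_cases hc : vac A μ a (l + 1) ≤ x + y
  · left
    refine caseA hA hA2 hg hG hy.le ?_ hc
    intro p hp
    rw [hE.eq] at hp
    rcases Multiset.mem_cons.1 hp with rfl | hp
    · exact le_rfl
    · exact (hE.mn p hp).1
  right
  have hc : x + y + 1 ≤ vac A μ a (l + 1) := by omega
  rcases Nat.eq_zero_or_pos l with h0 | h0
  · have e : N2 = (k + 1, y) ::ₘ N1 := by
      have := hG.eq
      rw [h0, cl_cons_zero, cl_eq hG.pos, hE.eq] at this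
      exact this.symm
    have e2 : N1 = cl ((l, vac A μ a l - x) ::ₘ N1) := by
      rw [h0, cl_cons_zero, cl_eq hpN1]
    rw [e] at hG
    rw [e2]
    rw [e2] at hE
    exact Ldist hA hA2 hg hG hE hc
  · have e := hG.eq
    rw [cl_cons_pos h0, cl_eq hG.pos, hE.eq] at e
    have key : (∃ N, N2 = (k + 1, y) ::ₘ N ∧ N1 = (l, vac A μ a l - x) ::ₘ N) ∨
        ((k + 1, y) = (l, vac A μ a l - x) ∧ N1 = N2 ∧ (k + 1, y) ∉ N1) := by
      rcases Multiset.cons_eq_cons.1 e with ⟨e1, e2⟩ | ⟨_, N, e1, e2⟩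
      · by_cases hm : (k + 1, y) ∈ N1
        · obtain ⟨N, hN⟩ := Multiset.exists_cons_of_mem hm
          left
          exact ⟨N, by rw [← e2, hN], by rw [hN, ← e1]⟩
        · right; exact ⟨e1, e2, hm⟩
      · left; exact ⟨N, e2, e1⟩
    rcases key with ⟨N, rfl, e2⟩ | ⟨e1, rfl, e3⟩
    · have hpN := (pos_cons.1 hG.pos).2
      have e3 : N1 = cl ((l, vac A μ a l - x) ::ₘ N) := by
        rw [e2, cl_cons_pos h0, cl_eq hpN]
      subst e3
      exact Ldist hA hA2 hg hG hE hc
    · obtain ⟨h1, h2⟩ := Prod.mk.inj e1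
      subst h1
      exact Luniq hA hA2 hg hG hE (by omega) e3 hc

/-- Generated by the star operators only. -/
inductive SS (A : I → I → ℤ) : RCraw I → Prop
  | empty : SS A emptyRC
  | step (a : I) (ν : RCraw I) : SS A ν → SS A (fStar A a ν)

theorem SS.good {A : I → I → ℤ} {ν : RCraw I} (h : SS A ν) : Good ν := by
  induction h with
  | empty => exact good_empty
  | step a ν _ ih => exact good_fStar a ih

theorem real_e {A : I → I → ℤ} (hA : IsBorcherdsCartan A) {a : I} (hA2 : A a a = 2)
    {μ ν' : RCraw I} (hμ : SS A μ) (ih : ∀ ν1, eOp A a μ = some ν1 → SS A ν1)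
    (he : eOp A a (fStar A a μ) = some ν') : SS A ν' := by
  have hg := hμ.good
  have hfg : fOp A a μ = fStar A a μ → SS A ν' := by
    intro h
    obtain ⟨N, l, x, hF⟩ := exists_FSpec a (hg.1 a)
    rw [← h, fOp_eq A hF, eOp_eq ((good_F hg hF.pos).1 a) (EF hA2 hF), ERes_FRes hF] at he
    rw [← Option.some.inj he]; exact hμ
  by_cases hr : ∀ p ∈ μ a, 0 ≤ p.2
  · rcases L0 hA hA2 hg hr with h | h
    · exact hfg h
    · exfalso
      obtain ⟨N, k, y, hE, _⟩ := eOp_some ((good_fStar a hg).1 a) he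
      have := (ec2 hA2).1 hE.c
      have h2 := h (k + 1, y) (by rw [hE.eq]; exact Multiset.mem_cons_self _ _)
      simp only at h2
      omega
  · obtain ⟨N, l, x, hF⟩ := exists_FSpec a (hg.1 a)
    push Not at hr
    obtain ⟨p, hp, hp2⟩ := hr
    have hpx : x ≤ p.2 := by
      rw [hF.eq] at hp
      rcases mem_cl_cons hp with ⟨rfl, _⟩ | hp
      · exact le_rfl
      · exact (hF.mn p hp).1
    have hl : 0 < l := by
      rcases Nat.eq_zero_or_pos l with h0 | h0
      · have := hF.z h0; omega
      · exact h0
    obtain ⟨N1, k, hE⟩ := exists_ESpec (A := A) (y := x) (hg.1 a) ((ec2 hA2).2 (by omega))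
      (by
        intro q hq
        rw [hF.eq] at hq
        rcases mem_cl_cons hq with ⟨rfl, _⟩ | hq
        · exact le_rfl
        · exact (hF.mn q hq).1)
      ⟨(l, x), by rw [hF.eq]; exact mem_cl_head hl, rfl⟩
    rcases L hA hA2 hg hE with h | ⟨N', k', y', h1, h2, _⟩
    · exact hfg h
    · rw [eOp_eq ((good_fStar a hg).1 a) h1, h2] at he
      rw [← Option.some.inj he]
      exact SS.step _ _ (ih _ (eOp_eq (hg.1 a) hE))

theorem real_f {A : I → I → ℤ} (hA : IsBorcherdsCartan A) {a : I} (hA2 : A a a = 2)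
    {μ : RCraw I} (hμ : SS A μ) (ih : SS A (fOp A a μ)) : SS A (fOp A a (fStar A a μ)) := by
  have hg := hμ.good
  have hgν := good_fStar (A := A) a hg
  have hgt := good_th (A := A) hg
  obtain ⟨N, l, x, hF⟩ := exists_FSpec a (hgt.1 a)
  have e := th_fStar A a hg
  have hE := EF (A := A) hA2 hF
  have hR := ERes_FRes (A := A) hF
  rw [← fOp_eq A hF, ← e] at hE hR
  have hgtν : Good (th A (fStar A a μ)) := good_th hgν
  rcases L hA hA2 hgtν hE with h | ⟨N', k', y', h1, h2, h3⟩
  · have h' := congrArg (th A) h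
    rw [th_fOp A a hgtν, th_fStar A a hgtν, th_th] at h'
    rw [← h']
    exact SS.step _ _ (SS.step _ _ hμ)
  · rw [hR] at h2
    have h4 := FE hA2 ((good_fStar a hgtν).1 a) h1 (h3 (fun h0 => by
      have := hF.z h0; rw [hA2]; omega))
    rw [h2, ← th_fOp A a hg] at h4
    have h5 := congrArg (th A) h4
    rw [th_fStar A a hgtν, th_th, th_fOp A a (good_th (good_fOp a hg)), th_th] at h5
    rw [← h5]
    exact SS.step _ _ ih

/-! ### Imaginary colors -/

theorem two {M N1 N2 : Multiset (ℕ × ℤ)} {k l : ℕ} {r s : ℤ} (h1 : M = cl ((k, r) ::ₘ N1))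
    (h2 : M = cl ((l, s) ::ₘ N2)) (p1 : Pos N1) (p2 : Pos N2)
    (hne : 0 < k → 0 < l → (k, r) ≠ (l, s)) :
    ∃ N, Pos N ∧ N1 = cl ((l, s) ::ₘ N) ∧ N2 = cl ((k, r) ::ₘ N) := by
  rcases Nat.eq_zero_or_pos k with rfl | hk
  · refine ⟨N2, p2, ?_, ?_⟩
    · rw [← h2, h1, cl_cons_zero, cl_eq p1]
    · rw [cl_cons_zero, cl_eq p2]
  rcases Nat.eq_zero_or_pos l with rfl | hl
  · refine ⟨N1, p1, ?_, ?_⟩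
    · rw [cl_cons_zero, cl_eq p1]
    · rw [← h1, h2, cl_cons_zero, cl_eq p2]
  rw [cl_cons_pos hk, cl_eq p1] at h1
  rw [cl_cons_pos hl, cl_eq p2, h1] at h2
  rcases Multiset.cons_eq_cons.1 h2 with ⟨e1, _⟩ | ⟨_, N, e1, e2⟩
  · exact absurd e1 (hne hk hl)
  · have hN : Pos N := by
      rw [e1] at p1; exact (pos_cons.1 p1).2
    refine ⟨N, hN, ?_, ?_⟩
    · rw [e1, cl_cons_pos hl, cl_eq hN]
    · rw [e2, cl_cons_pos hk, cl_eq hN]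

theorem T_fStar_same {A : I → I → ℤ} (a : I) {ν : RCraw I} (h : Good ν) (i : ℕ) :
    T A a (fStar A a ν) i = T A a ν i := by
  obtain ⟨N, l, x, hG⟩ := exists_GSpec A a (h.1 a)
  rw [fStar_eq hG]
  apply W_congr
  intro b hb
  simp only [GRes, if_neg hb]

theorem T_congr {A : I → I → ℤ} (a : I) {ν ν' : RCraw I} (i : ℕ)
    (h : ∀ b, b ≠ a → ss (gt i) (ν' b) = ss (gt i) (ν b)) : T A a ν' i = T A a ν i :=
  W_congr A a a _ h

/-- Changing another color by `f_b^*` keeps the rows and increases the vacancy numbers. -/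
theorem other_step {A : I → I → ℤ} (hA : IsBorcherdsCartan A) {a b : I} (hab : a ≠ b)
    {ν : RCraw I} (h : Good ν) :
    fStar A b ν a = ν a ∧ (∀ i, vac A ν a i ≤ vac A (fStar A b ν) a i) ∧
      T A a ν 0 ≤ T A a (fStar A b ν) 0 := by
  obtain ⟨N, l, x, hG⟩ := exists_GSpec A b (h.1 b)
  have hv := vac_G (A := A) (x := x) h hG.pos hG.eq
  have e : fStar A b ν a = ν a := by
    rw [fStar_eq hG]; simp only [GRes, if_neg hab]
  have hvac : ∀ i, vac A ν a i ≤ vac A (fStar A b ν) a i := by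
    intro i
    rw [fStar_eq hG, hv]
    have := hA.offdiag a b hab
    split_ifs <;> omega
  refine ⟨e, hvac, ?_⟩
  have h1 := vac_succ A a h 0
  have h2 := vac_succ A a (good_fStar (A := A) b h) 0
  have h3 := hvac (0 + 1)
  rw [e, vac_zero] at h2
  rw [vac_zero] at h1
  omega

/-- Invariant for imaginary colors with negative diagonal entry `-2 * h`. -/
structure InvN (A : I → I → ℤ) (a : I) (h : ℤ) (ν : RCraw I) : Prop where
  r : ∀ p ∈ ν a, p.1 = 1 ∧ h ≤ p.2 ∧ h ≤ vac A ν a 1 - p.2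
  q : T A a ν 0 = 0 →
    (1, h) ::ₘ sh (A a a) 0 (ν a) = (1, 2 * h * (Multiset.card (ν a) : ℤ) + h) ::ₘ ν a

theorem ss_gt_zero {M : Multiset (ℕ × ℤ)} (h : Pos M) : ss (gt 0) M = Multiset.card M := by
  unfold ss
  have : M.map (fun p => gt 0 p.1) = M.map (fun _ => (1 : ℤ)) := by
    apply Multiset.map_congr rfl
    intro p hp
    have := h p hp
    simp [gt, this]
  rw [this]
  simp

theorem vac_one {A : I → I → ℤ} {a : I} {ν : RCraw I} (hg : Good ν) :
    vac A ν a 1 = -A a a * (Multiset.card (ν a) : ℤ) + T A a ν 0 := by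
  have := vac_succ A a hg 0
  rw [vac_zero, ss_gt_zero (hg.1 a)] at this
  simpa using this

theorem InvN.gspec {A : I → I → ℤ} {a : I} {h : ℤ} {ν : RCraw I} (hg : Good ν)
    (hi : InvN A a h ν) (hh : 0 < h) : GSpec A a ν (ν a) 0 0 := by
  refine ⟨?_, fun _ => rfl, hg.1 a, le_rfl, ?_⟩
  · rw [cl_cons_zero, cl_eq (hg.1 a)]
  · intro p hp
    obtain ⟨h1, h2, h3⟩ := hi.r p hp
    rw [h1]
    exact ⟨by omega, fun h => by omega⟩

theorem InvN.fspec {A : I → I → ℤ} {a : I} {h : ℤ} {ν : RCraw I} (hg : Good ν)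
    (hi : InvN A a h ν) (hh : 0 < h) : FSpec a ν (ν a) 0 0 := by
  refine ⟨?_, fun _ => rfl, hg.1 a, le_rfl, ?_⟩
  · rw [cl_cons_zero, cl_eq (hg.1 a)]
  · intro p hp
    obtain ⟨h1, h2, h3⟩ := hi.r p hp
    exact ⟨by omega, fun h => by omega⟩

theorem SS.invN {A : I → I → ℤ} (hA : IsBorcherdsCartan A) {a : I} {h : ℤ} (hh : 0 < h)
    (ha : A a a = -2 * h) {ν : RCraw I} (hν : SS A ν) : InvN A a h ν := by
  induction hν with
  | empty =>
    refine ⟨?_, ?_⟩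
    · intro p hp; simp [emptyRC] at hp
    · intro _; simp [emptyRC, sh]
  | step b ν hν ih =>
    have hg := hν.good
    by_cases hab : a = b
    · subst hab
      have hG := ih.gspec hg hh
      have hv := vac_G (A := A) (x := 0) hg hG.pos hG.eq
      have hv1 := vac_one (A := A) (a := a) hg
      have hT := T_nonneg hA a ν 0
      have hc : 0 ≤ (2 * h) * (Multiset.card (ν a) : ℤ) := by positivity
      have e1 : -A a a * (Multiset.card (ν a) : ℤ) = 2 * h * (Multiset.card (ν a) : ℤ) := by
        rw [ha]; ring
      have e : fStar A a ν a = (1, vac A ν a 1 + h) ::ₘ ν a := by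
        rw [fStar_eq hG]
        simp only [GRes, if_true]
        congr 2
        simp only [zero_add]
        omega
      refine ⟨?_, ?_⟩
      · intro p hp
        rw [e] at hp
        rw [fStar_eq hG, hv, if_pos (by omega)]
        rcases Multiset.mem_cons.1 hp with rfl | hp
        · exact ⟨rfl, by simp only; omega, by simp only; omega⟩
        · obtain ⟨h1, h2, h3⟩ := ih.r p hp
          exact ⟨h1, h2, by omega⟩
      · rw [T_fStar_same a hg, e]
        intro hT0
        have hq := ih.q hT0
        rw [sh_cons, Multiset.cons_swap, hq, Multiset.card_cons]
        have e2 : vac A ν a 1 = 2 * h * (Multiset.card (ν a) : ℤ) := by omega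
        simp only
        rw [if_pos (by omega), e2]
        congr 2
        push_cast
        rw [ha]; ring
    · obtain ⟨h1, h2, h3⟩ := other_step hA hab hg
      refine ⟨?_, ?_⟩
      · intro p hp
        rw [h1] at hp
        obtain ⟨i1, i2, i3⟩ := ih.r p hp
        have := h2 1
        exact ⟨i1, i2, by omega⟩
      · intro hT
        rw [h1]
        have := T_nonneg hA a ν 0
        exact ih.q (by omega)

theorem InvN.im1 {A : I → I → ℤ} (hA : IsBorcherdsCartan A) {a : I} {h : ℤ} (hh : 0 < h)
    (ha : A a a = -2 * h) {ν : RCraw I} (hg : Good ν) (hi : InvN A a h ν) (hT : T A a ν 0 = 0) :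
    fOp A a ν = fStar A a ν := by
  rw [fOp_eq A (hi.fspec hg hh), fStar_eq (hi.gspec hg hh)]
  have hv1 := vac_one (A := A) (a := a) hg
  funext c
  by_cases hca : c = a
  · subst hca
    simp only [FRes, GRes, if_true]
    have hq := hi.q hT
    have e1 : (0 : ℤ) - A c c / 2 = h := by omega
    have e2 : vac A ν c (0 + 1) - A c c - (0 - A c c / 2) =
        2 * h * (Multiset.card (ν c) : ℤ) + h := by
      have e3 : -A c c * (Multiset.card (ν c) : ℤ) = 2 * h * (Multiset.card (ν c) : ℤ) := by
        rw [ha]; ring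
      simp only [zero_add]
      omega
    rw [e2, e1]
    exact hq
  · simp only [FRes, GRes, if_neg hca]
    exact sh_id (T_zero_sh hA hg hT hca)

/-- Invariant for imaginary colors with zero diagonal entry. -/
structure InvZ (A : I → I → ℤ) (a : I) (ν : RCraw I) : Prop where
  r : ∀ p ∈ ν a, 0 ≤ p.2 ∧ 0 ≤ vac A ν a p.1 - p.2
  q : T A a ν 0 = 0 → Multiset.card (ν a) ≤ 1

theorem vacZ_nonneg {A : I → I → ℤ} (hA : IsBorcherdsCartan A) {a : I} (ha : A a a = 0)
    {ν : RCraw I} (hg : Good ν) (i : ℕ) : 0 ≤ vac A ν a i := by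
  induction i with
  | zero => rw [vac_zero]
  | succ i ih =>
    have := vac_succ A a hg i
    have := T_nonneg hA a ν i
    rw [ha] at *
    omega

theorem vacZ_pos {A : I → I → ℤ} (hA : IsBorcherdsCartan A) {a : I} (ha : A a a = 0)
    {ν : RCraw I} (hg : Good ν) (hT : 0 < T A a ν 0) (i : ℕ) : 0 < vac A ν a (i + 1) := by
  induction i with
  | zero =>
    have := vac_succ A a hg 0
    rw [ha, vac_zero] at this
    omega
  | succ i ih =>
    have := vac_succ A a hg (i + 1)
    have := T_nonneg hA a ν (i + 1)
    rw [ha] at *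
    omega

theorem vacZ_zero {A : I → I → ℤ} (hA : IsBorcherdsCartan A) {a : I} (ha : A a a = 0)
    {ν : RCraw I} (hg : Good ν) (hT : T A a ν 0 = 0) (i : ℕ) : vac A ν a i = 0 := by
  induction i with
  | zero => rw [vac_zero]
  | succ i ih =>
    have := vac_succ A a hg i
    have := T_nonneg hA a ν i
    have := T_anti hA a hg (Nat.zero_le i)
    rw [ha] at *
    omega

theorem InvZ.gx {A : I → I → ℤ} {a : I} {ν : RCraw I} (hi : InvZ A a ν)
    {N : Multiset (ℕ × ℤ)} {l : ℕ} {x : ℤ} (hG : GSpec A a ν N l x) : x = 0 := by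
  rcases Nat.eq_zero_or_pos l with h0 | h0
  · exact hG.z h0
  · have := hi.r (l, vac A ν a l - x) (by rw [hG.eq]; exact mem_cl_head h0)
    have := hG.le
    simp only at *
    omega

theorem InvZ.fx {A : I → I → ℤ} {a : I} {ν : RCraw I} (hi : InvZ A a ν)
    {N : Multiset (ℕ × ℤ)} {l : ℕ} {x : ℤ} (hF : FSpec a ν N l x) : x = 0 := by
  rcases Nat.eq_zero_or_pos l with h0 | h0
  · exact hF.z h0
  · have := hi.r (l, x) (by rw [hF.eq]; exact mem_cl_head h0)
    have := hF.le
    simp only at *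
    omega

/-- If all neighbours are empty there is at most one row, with zero rigging. -/
theorem InvZ.shape {A : I → I → ℤ} (hA : IsBorcherdsCartan A) {a : I} (ha : A a a = 0)
    {ν : RCraw I} (hg : Good ν) (hi : InvZ A a ν) (hT : T A a ν 0 = 0) :
    ∃ l, ν a = cl {(l, 0)} := by
  have hc := hi.q hT
  rcases Nat.lt_or_ge (Multiset.card (ν a)) 1 with h | h
  · refine ⟨0, ?_⟩
    rw [Multiset.card_eq_zero.1 (by omega : Multiset.card (ν a) = 0)]
    exact (cl_cons_zero (M := 0)).symm
  · obtain ⟨⟨l, r⟩, hp⟩ := Multiset.card_eq_one.1 (by omega : Multiset.card (ν a) = 1)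
    have h1 := hi.r (l, r) (by rw [hp]; simp)
    have h2 := hg.1 a (l, r) (by rw [hp]; simp)
    simp only [vacZ_zero hA ha hg hT] at h1 h2
    have : r = 0 := by omega
    subst this
    refine ⟨l, ?_⟩
    rw [hp, cl_eq]
    intro q hq
    rw [Multiset.mem_singleton.1 hq]; exact h2

theorem InvZ.specs {A : I → I → ℤ} (hA : IsBorcherdsCartan A) {a : I} (ha : A a a = 0)
    {ν : RCraw I} (hg : Good ν) (hi : InvZ A a ν) (hT : T A a ν 0 = 0) :
    ∃ l, FSpec a ν 0 l 0 ∧ GSpec A a ν 0 l 0 := by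
  obtain ⟨l, hl⟩ := hi.shape hA ha hg hT
  have p0 : Pos 0 := fun p hp => by simp at hp
  refine ⟨l, ⟨hl, fun _ => rfl, p0, le_rfl, fun p hp => by simp at hp⟩,
    ⟨?_, fun _ => rfl, p0, le_rfl, fun p hp => by simp at hp⟩⟩
  rw [vacZ_zero hA ha hg hT]
  exact hl

theorem SS.invZ {A : I → I → ℤ} (hA : IsBorcherdsCartan A) {a : I}
    (ha : A a a = 0) {ν : RCraw I} (hν : SS A ν) : InvZ A a ν := by
  induction hν with
  | empty =>
    refine ⟨?_, ?_⟩
    · intro p hp; simp [emptyRC] at hp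
    · intro _; simp [emptyRC]
  | step b ν hν ih =>
    have hg := hν.good
    by_cases hab : a = b
    · subst hab
      refine ⟨?_, ?_⟩
      · obtain ⟨N, l, x, hG⟩ := exists_GSpec A a (hg.1 a)
        have hx := ih.gx hG
        subst hx
        have hv := vac_G (A := A) (x := 0) hg hG.pos hG.eq
        have hn := vacZ_nonneg hA ha hg (l + 1)
        rw [fStar_eq hG]
        intro p hp
        rw [hv]
        simp only [GRes, if_true] at hp
        rw [ha]
        rw [ha] at hp
        rcases Multiset.mem_cons.1 hp with rfl | hp
        · constructor
          · simp only; omega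
          · simp
        · have := ih.r p (by rw [hG.eq]; exact mem_cl_of_mem hG.pos hp)
          simpa using this
      · rw [T_fStar_same a hg]
        intro hT
        obtain ⟨l, _, hG⟩ := ih.specs hA ha hg hT
        rw [fStar_eq hG]
        simp [GRes]
    · obtain ⟨h1, h2, h3⟩ := other_step hA hab hg
      refine ⟨?_, ?_⟩
      · intro p hp
        rw [h1] at hp
        have := ih.r p hp
        have := h2 p.1
        exact ⟨by omega, by omega⟩
      · intro hT
        rw [h1]
        have := T_nonneg hA a ν 0
        exact ih.q (by omega)

theorem InvZ.im1 {A : I → I → ℤ} (hA : IsBorcherdsCartan A) {a : I} (ha : A a a = 0)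
    {ν : RCraw I} (hg : Good ν) (hi : InvZ A a ν) (hT : T A a ν 0 = 0) :
    fOp A a ν = fStar A a ν := by
  obtain ⟨l, hF, hG⟩ := hi.specs hA ha hg hT
  rw [fOp_eq A hF, fStar_eq hG]
  funext c
  by_cases hca : c = a
  · subst hca
    simp only [FRes, GRes, if_true]
    rw [ha, vacZ_zero hA ha hg hT, sh_zero]
    rfl
  · simp only [FRes, GRes, if_neg hca]
    apply sh_id
    intro p hp
    rcases T_zero_sh hA hg hT hca p hp with h | h
    · exact Or.inl h
    · right; omega

theorem imag_cases {A : I → I → ℤ} (hA : IsBorcherdsCartan A) {a : I} (ha : A a a ≤ 0) :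
    A a a = 0 ∨ ∃ h, 0 < h ∧ A a a = -2 * h := by
  rcases hA.diag a with h | ⟨_, ⟨r, hr⟩⟩
  · omega
  · rcases eq_or_lt_of_le ha with h | h
    · exact Or.inl h
    · exact Or.inr ⟨-r, by omega, by omega⟩

theorem im1 {A : I → I → ℤ} (hA : IsBorcherdsCartan A) {a : I} (ha : A a a ≤ 0) {ν : RCraw I}
    (hν : SS A ν) (hT : T A a ν 0 = 0) : fOp A a ν = fStar A a ν := by
  rcases imag_cases hA ha with h | ⟨h, h1, h2⟩
  · exact (hν.invZ hA h).im1 hA h hν.good hT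
  · exact (hν.invN hA h1 h2).im1 hA h1 h2 hν.good hT

theorem imag_f {A : I → I → ℤ} (hA : IsBorcherdsCartan A) {a : I} (ha : A a a ≤ 0)
    {μ : RCraw I} (hμ : SS A μ) (ih : SS A (fOp A a μ)) : SS A (fOp A a (fStar A a μ)) := by
  have hg := hμ.good
  by_cases hT : T A a μ 0 = 0
  · rw [im1 hA ha (SS.step a μ hμ) (by rw [T_fStar_same a hg, hT])]
    exact SS.step _ _ (SS.step _ _ hμ)
  have hT' : 0 < T A a μ 0 := by
    have := T_nonneg hA a μ 0; omega
  suffices hs : fOp A a (fStar A a μ) = fStar A a (fOp A a μ) by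
    rw [hs]; exact SS.step _ _ ih
  rcases imag_cases hA ha with h | ⟨h, h1, h2⟩
  · have hi := hμ.invZ hA h
    have hpos := vacZ_pos hA h hg hT'
    obtain ⟨N1, k, y, hF⟩ := exists_FSpec a (hg.1 a)
    obtain ⟨N2, l, x, hG⟩ := exists_GSpec A a (hg.1 a)
    have hx := hi.gx hG
    have hy := hi.fx hF
    subst hx
    subst hy
    have hpl : ∀ j, 0 < j → 0 < vac A μ a j := by
      intro j hj
      have := hpos (j - 1)
      rwa [Nat.sub_add_cancel hj] at this
    obtain ⟨N, hN, rfl, rfl⟩ := two hF.eq hG.eq hF.pos hG.pos (by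
      intro hk hl e
      have := (Prod.mk.inj e).2
      have := hpl l hl
      omega)
    have hl := fun h0 => hF.mn (l, vac A μ a l - 0) (mem_cl_head h0)
    have hk := fun h0 => hG.mn (k, 0) (mem_cl_head h0)
    refine commF hg (N := N) (k := k) (l := l) (x := 0) (y := 0)
      (R := vac A μ a (l+1) - A a a - (0 - A a a / 2)) ?_ hN hF.z hG.z le_rfl le_rfl
      (fun p hp => hF.mn p (mem_cl_of_mem hN hp)) (fun p hp => hG.mn p (mem_cl_of_mem hN hp))
      hl hk rfl ?_ ?_
    · rw [hF.eq, cl_cons_cl]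
    · have := hpos l
      rw [h]; exact ⟨by omega, fun _ => by omega⟩
    · have := hpos k
      rw [h]; exact ⟨by omega, fun _ => by omega⟩
  · have hi := hμ.invN hA h1 h2
    have hF := hi.fspec hg h1
    have hG := hi.gspec hg h1
    have hv1 := vac_one (A := A) (a := a) hg
    have hc : 0 ≤ (2 * h) * (Multiset.card (μ a) : ℤ) := by positivity
    have e1 : -A a a * (Multiset.card (μ a) : ℤ) = 2 * h * (Multiset.card (μ a) : ℤ) := by
      rw [h2]; ring
    refine commF hg (N := μ a) (k := 0) (l := 0) (x := 0) (y := 0) ?_ (hg.1 a) hF.z hG.z le_rfl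
      le_rfl hF.mn hG.mn (fun h => by omega) (fun h => by omega) rfl ?_ ?_
    · rw [cl_cons_zero, cl_cons_zero, cl_eq (hg.1 a)]
    · simp only [zero_add]
      exact ⟨by omega, fun _ => by omega⟩
    · simp only [zero_add]
      exact ⟨by omega, fun _ => by omega⟩

theorem ecI {A : I → I → ℤ} {a : I} (ha : A a a ≤ 0) {y : ℤ} : EC A a y ↔ y = -A a a / 2 := by
  unfold EC
  constructor
  · rintro (h | h)
    · omega
    · exact h.2
  · intro h; exact Or.inr ⟨by omega, h⟩

theorem imag_e {A : I → I → ℤ} (hA : IsBorcherdsCartan A) {a : I} (ha : A a a ≤ 0)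
    {μ ν' : RCraw I} (hμ : SS A μ) (ih : ∀ ν1, eOp A a μ = some ν1 → SS A ν1)
    (he : eOp A a (fStar A a μ) = some ν') : SS A ν' := by
  have hg := hμ.good
  have hgg := good_fStar (A := A) a hg
  have hT := T_nonneg hA a μ 0
  -- the case where everything is trivial
  have triv : ∀ l, FSpec a μ 0 l 0 → T A a μ 0 = 0 → SS A ν' := by
    intro l hF hT
    have hE : ESpec A a (FRes A a μ 0 l 0) 0 l (0 - A a a / 2) := by
      refine ⟨by simp [FRes, sh], (ecI ha).2 ?_, fun p hp => by simp at hp⟩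
      rcases imag_cases hA ha with h | ⟨h, h1, h2⟩ <;> omega
    have hr := ERes_FRes (A := A) hF
    rw [sh_empty] at hr
    rw [← im1 hA ha hμ hT, fOp_eq A hF, eOp_eq ((good_F hg hF.pos).1 a) hE, hr] at he
    rw [← Option.some.inj he]; exact hμ
  obtain ⟨N', k', y', hE', rfl⟩ := eOp_some (hgg.1 a) he
  have hy' := (ecI ha).1 hE'.c
  have hmem : (k' + 1, y') ∈ fStar A a μ a := by
    rw [hE'.eq]; exact Multiset.mem_cons_self _ _
  -- conclusion from commutation
  have concl : ∀ {k N1 N2 y}, ESpec A a μ N1 k y → ESpec A a (fStar A a μ) N2 k y →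
      ERes A a (fStar A a μ) N2 k y = fStar A a (ERes A a μ N1 k y) →
      SS A (ERes A a (fStar A a μ) N' k' y') := by
    intro k N1 N2 y h1 h2 h3
    rw [eOp_eq (hgg.1 a) h2, h3] at he
    rw [← Option.some.inj he]
    exact SS.step _ _ (ih _ (eOp_eq (hg.1 a) h1))
  rcases imag_cases hA ha with h | ⟨h, h1, h2⟩
  · have hi := hμ.invZ hA h
    by_cases hT0 : T A a μ 0 = 0
    · obtain ⟨l, hF, _⟩ := hi.specs hA h hg hT0
      exact triv l hF hT0
    have hpos := vacZ_pos hA h hg (by omega)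
    have hpl : ∀ j, 0 < j → 0 < vac A μ a j := by
      intro j hj
      have := hpos (j - 1)
      rwa [Nat.sub_add_cancel hj] at this
    obtain ⟨N2, l, x, hG⟩ := exists_GSpec A a (hg.1 a)
    have hx := hi.gx hG
    subst hx
    have hy0 : y' = 0 := by rw [hy', h]; rfl
    subst hy0
    have hmem2 : (k' + 1, (0 : ℤ)) ∈ μ a := by
      rw [fStar_eq hG] at hmem
      simp only [GRes, if_true] at hmem
      rcases Multiset.mem_cons.1 hmem with e | hm
      · have h3 := (Prod.mk.inj e).2
        have := hpos l
        rw [h] at h3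
        omega
      · rw [hG.eq]; exact mem_cl_of_mem hG.pos hm
    obtain ⟨N1, k, hE⟩ := exists_ESpec (A := A) (y := 0) (hg.1 a) hE'.c (fun p hp => (hi.r p hp).1)
      ⟨_, hmem2, rfl⟩
    have hpN1 : Pos N1 := by
      have := hg.1 a
      rw [hE.eq] at this; exact (pos_cons.1 this).2
    have e1 : μ a = cl ((k + 1, 0) ::ₘ N1) := by
      rw [hE.eq, cl_cons_pos (Nat.succ_pos k), cl_eq hpN1]
    obtain ⟨N, hN, rfl, e2⟩ := two e1 hG.eq hpN1 hG.pos (by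
      intro hk hl e
      have := (Prod.mk.inj e).2
      have := hpl l hl
      omega)
    rw [cl_cons_pos (Nat.succ_pos k), cl_eq hN] at e2
    subst e2
    obtain ⟨_, _, h3, h4, h5⟩ := commE hg hG hE.c
      (fun p hp => hE.mn p (mem_cl_of_mem hN hp))
      (fun h0 => hE.mn _ (mem_cl_head h0)) rfl
      (by
        have := hpos l
        rw [h]
        exact ⟨by omega, fun _ => by omega⟩)
      (fun h0 => by
        have := hpl k h0
        rw [h]
        exact ⟨by omega, fun _ => by omega⟩)
    exact concl h3 h4 h5
  · have hi := hμ.invN hA h1 h2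
    have hF := hi.fspec hg h1
    have hG := hi.gspec hg h1
    have hv1 := vac_one (A := A) (a := a) hg
    have hc : 0 ≤ (2 * h) * (Multiset.card (μ a) : ℤ) := by positivity
    have e1 : -A a a * (Multiset.card (μ a) : ℤ) = 2 * h * (Multiset.card (μ a) : ℤ) := by
      rw [h2]; ring
    have hyh : y' = h := by omega
    subst hyh
    by_cases hv : vac A μ a 1 = 0
    · have hc0 : (2 * y') * (Multiset.card (μ a) : ℤ) = 0 := by omega
      have hM : μ a = 0 := by
        rcases mul_eq_zero.1 hc0 with h | h
        · omega
        · exact Multiset.card_eq_zero.1 (by exact_mod_cast h)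
      rw [hM] at hF
      exact triv 0 hF (by omega)
    · have hmem2 : (k' + 1, y') ∈ μ a := by
        rw [fStar_eq hG] at hmem
        simp only [GRes, if_true, zero_add] at hmem
        rcases Multiset.mem_cons.1 hmem with e | hm
        · have h3 := (Prod.mk.inj e).2
          omega
        · exact hm
      obtain ⟨N1, k, hE⟩ := exists_ESpec (A := A) (y := y') (hg.1 a) hE'.c
        (fun p hp => (hi.r p hp).2.1) ⟨_, hmem2, rfl⟩
      have hk := (hi.r (k + 1, y') (by rw [hE.eq]; exact Multiset.mem_cons_self _ _)).1
      simp only at hk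
      have hk0 : k = 0 := by omega
      subst hk0
      rw [hE.eq] at hG
      obtain ⟨_, _, h3, h4, h5⟩ := commE hg hG hE.c hE.mn (fun h => by omega) rfl
        (by
          simp only [zero_add]
          exact ⟨by omega, fun _ => by omega⟩)
        (fun h => by omega)
      exact concl h3 h4 h5

/-! ### Closure -/

theorem vac_empty (A : I → I → ℤ) (a : I) (i : ℕ) : vac A emptyRC a i = 0 := by
  simp [vac, emptyRC]

theorem f_empty {A : I → I → ℤ} (hA : IsBorcherdsCartan A) (a : I) :
    fOp A a emptyRC = fStar A a emptyRC := by
  have p0 : Pos 0 := fun p hp => by simp at hp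
  have hF : FSpec a (emptyRC : RCraw I) 0 0 0 :=
    ⟨by rw [cl_cons_zero]; rfl, fun _ => rfl, p0, le_rfl, fun p hp => by simp at hp⟩
  have hG : GSpec A a (emptyRC : RCraw I) 0 0 0 :=
    ⟨by rw [cl_cons_zero]; rfl, fun _ => rfl, p0, le_rfl, fun p hp => by simp at hp⟩
  rw [fOp_eq A hF, fStar_eq hG]
  funext c
  by_cases hca : c = a
  · subst hca
    simp only [FRes, GRes, if_true, sh_empty, vac_empty]
    congr 2
    rcases hA.diag c with h | ⟨_, ⟨r, hr⟩⟩ <;> omega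
  · simp only [FRes, GRes, if_neg hca]
    simp [emptyRC, sh]

theorem SS.f {A : I → I → ℤ} (hA : IsBorcherdsCartan A) {ν : RCraw I} (h : SS A ν) (a : I) :
    SS A (fOp A a ν) := by
  induction h with
  | empty => rw [f_empty hA]; exact SS.step _ _ SS.empty
  | step b μ hμ ih =>
    by_cases hab : a = b
    · subst hab
      rcases hA.diag a with h | ⟨h, _⟩
      · exact real_f hA h hμ ih
      · exact imag_f hA h hμ ih
    · rw [C1f hab hμ.good]
      exact SS.step _ _ ih

theorem SS.e {A : I → I → ℤ} (hA : IsBorcherdsCartan A) {ν : RCraw I} (h : SS A ν) (a : I) :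
    ∀ ν', eOp A a ν = some ν' → SS A ν' := by
  induction h with
  | empty =>
    intro ν' he
    obtain ⟨N, k, y, hE, _⟩ := eOp_some (good_empty.1 a) he
    have := hE.eq
    simp [emptyRC] at this
  | step b μ hμ ih =>
    intro ν' he
    by_cases hab : a = b
    · subst hab
      rcases hA.diag a with h | ⟨h, _⟩
      · exact real_e hA h hμ ih he
      · exact imag_e hA h hμ ih he
    · obtain ⟨ν1, h1, rfl⟩ := C1e hab hμ.good he
      exact SS.step _ _ (ih _ h1)

theorem RCinf.ss {A : I → I → ℤ} (hA : IsBorcherdsCartan A) {ν : RCraw I} (h : RCinf A ν) :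
    SS A ν := by
  induction h with
  | empty => exact SS.empty
  | fstep a ν _ ih => exact ih.f hA a
  | estep a ν ν' _ he ih => exact ih.e hA a _ he

/-! ### The statistic `tε_a^*` -/

theorem iterOpt_succ' {α : Type*} (g : α → Option α) (k : ℕ) (v : α) :
    iterOpt g (k + 1) v = (g v).bind (iterOpt g k) := by
  induction k with
  | zero => cases h : g v <;> simp [iterOpt, h]
  | succ k ih =>
    have e : iterOpt g (k + 1 + 1) v = (iterOpt g (k + 1) v).bind g := rfl
    rw [e, ih, Option.bind_assoc]
    rfl

/-- `e_a^*` can be applied exactly `n` times. -/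
inductive TE (A : I → I → ℤ) (a : I) : RCraw I → ℕ → Prop
  | zero (ν : RCraw I) : eStarOp A a ν = none → TE A a ν 0
  | succ (ν ν' : RCraw I) (n : ℕ) : eStarOp A a ν = some ν' → TE A a ν' n → TE A a ν (n + 1)

theorem TE.iter {A : I → I → ℤ} {a : I} {ν : RCraw I} {n : ℕ} (h : TE A a ν n) (k : ℕ) :
    iterOpt (eStarOp A a) k ν ≠ none ↔ k ≤ n := by
  induction h generalizing k with
  | zero ν h =>
    cases k with
    | zero => simp [iterOpt]
    | succ k => rw [iterOpt_succ', h]; simp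
  | succ ν ν' n h _ ih =>
    cases k with
    | zero => simp [iterOpt]
    | succ k =>
      rw [iterOpt_succ', h]
      simpa using ih k

theorem TE.eq {A : I → I → ℤ} {a : I} {ν : RCraw I} {n : ℕ} (h : TE A a ν n) :
    teStarRC A a ν = n := by
  unfold teStarRC
  have : {k | iterOpt (eStarOp A a) k ν ≠ none} = Set.Iic n := by
    ext k; exact h.iter k
  rw [this, csSup_Iic]

/-- The result of `e_a^*`. -/
noncomputable def SRes (A : I → I → ℤ) (a : I) (ν : RCraw I) (N : Multiset (ℕ × ℤ)) (k : ℕ)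
    (x : ℤ) : RCraw I := fun b =>
  if b = a then cl ((k, vac A ν a k - (x - A a a / 2)) ::ₘ N) else ν b

theorem eStar_eq {A : I → I → ℤ} {a : I} (ha : A a a ≤ 0) {ν : RCraw I}
    {N : Multiset (ℕ × ℤ)} {k : ℕ} {x : ℤ} (hx : x = -A a a / 2) (hp : Pos (ν a))
    (h1 : ν a = (k + 1, vac A ν a (k + 1) - x) ::ₘ N)
    (h3 : ∀ p ∈ N, x ≤ vac A ν a p.1 - p.2 ∧ (vac A ν a p.1 - p.2 = x → k + 1 ≤ p.1)) :
    eStarOp A a ν = some (SRes A a ν N k x) := by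
  have hN : Pos N := by rw [h1] at hp; exact (pos_cons.1 hp).2
  have hmin : minPosRows (corigs A ν a) = x := by
    apply minPosRows_eq
    · refine Multiset.mem_map.2 ⟨(k + 1, vac A ν a (k + 1) - x), ?_, by simp⟩
      rw [h1]; exact Multiset.mem_cons_self _ _
    · intro z hz
      obtain ⟨p, hp, rfl⟩ := Multiset.mem_map.1 hz
      rw [h1] at hp
      rcases Multiset.mem_cons.1 hp with rfl | hp
      · simp
      · exact (h3 p hp).1
  have hl : minPosRowsN (((ν a).filter fun p => vac A ν a p.1 - p.2 = x).map Prod.fst) = k + 1 := by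
    apply minPosRowsN_eq
    · refine Multiset.mem_map.2 ⟨(k + 1, vac A ν a (k + 1) - x), Multiset.mem_filter.2 ⟨?_, ?_⟩, rfl⟩
      · rw [h1]; exact Multiset.mem_cons_self _ _
      · simp
    · intro z hz
      obtain ⟨p, hp, rfl⟩ := Multiset.mem_map.1 hz
      obtain ⟨hp, hpx⟩ := Multiset.mem_filter.1 hp
      rw [h1] at hp
      rcases Multiset.mem_cons.1 hp with rfl | hp
      · exact le_refl _
      · exact (h3 p hp).2 hpx
  unfold eStarOp
  rw [if_neg (by omega), hmin, if_neg, ← hx]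
  · congr 1
    funext b
    unfold eStarRemove SRes
    simp only [hl]
    by_cases hb : b = a
    · subst hb
      simp only [if_true]
      have e : (ν b).erase (k + 1, vac A ν b (k + 1) - x) = N := by
        conv_lhs => rw [h1]
        exact Multiset.erase_cons_head _ _
      have e2 : cl ((k, vac A ν b k - (x - A b b / 2)) ::ₘ N)
          = N + (if k + 1 = 1 then 0 else
            {(k + 1 - 1, vac A ν b (k + 1 - 1) - (x - A b b / 2))}) := by
        rcases Nat.eq_zero_or_pos k with rfl | hk
        · rw [cl_cons_zero, cl_eq hN]; simp
        · rw [cl_cons_pos hk, cl_eq hN, if_neg (by omega), Nat.add_sub_cancel, add_comm,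
            Multiset.singleton_add]
      rw [e2]
      congr 1
    · simp only [if_neg hb]
  · rintro (h | h)
    · rw [h1] at h; simp at h
    · exact h hx

theorem good_S {A : I → I → ℤ} {a : I} {ν : RCraw I} {N : Multiset (ℕ × ℤ)} {k : ℕ} {x : ℤ}
    (h : Good ν) : Good (SRes A a ν N k x) := by
  apply good_of a h
  · intro b
    unfold SRes
    by_cases hb : b = a
    · simp only [if_pos hb]; exact pos_cl _
    · simp only [if_neg hb]; exact h.1 b
  · intro b hb h0
    simp only [SRes, if_neg hb, h0]

theorem Wid {A : I → I → ℤ} (hA : IsBorcherdsCartan A) (a : I) {ν : RCraw I} (h : Good ν) :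
    T A a ν 0 ≤ W A a a ν (fun j => (j : ℤ)) ∧
      (T A a ν 0 = 0 → W A a a ν (fun j => (j : ℤ)) = 0) := by
  constructor
  · have := W_nonneg hA a ν (φ := fun j => (j : ℤ) - gt 0 j) (by
      intro i; simp only [gt]; split_ifs <;> omega)
    rw [W_sub A a a h (fun j => (j : ℤ)) (gt 0)] at this
    unfold T; exact sub_nonneg.1 this
  · intro hT
    unfold W
    have : ∀ b, (if b = a then 0 else A a b) * ss (fun j => (j : ℤ)) (ν b) = 0 := by
      intro b
      by_cases hb : b = a
      · simp [hb]
      · rw [if_neg hb]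
        rcases W_eq_zero hA a h (gt_nonneg 0) hT b hb with h1 | h1
        · rw [h1, zero_mul]
        · rw [ss_eq_zero_of, mul_zero]
          intro p hp
          have := h1 p hp
          have h3 : p.1 = 0 := by
            by_contra hc
            rw [gt, if_pos (by omega)] at this
            omega
          simp [h3]
    rw [finsum_congr this]; simp

/-! ### Zero diagonal entry -/

/-- Number of boxes in rows of zero corigging with respect to the vacancy numbers `v`. -/
def Zc (v : ℕ → ℤ) (M : Multiset (ℕ × ℤ)) : ℕ :=
  (M.map fun p => if v p.1 - p.2 = 0 then p.1 else 0).sum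

theorem Zc_cons (v : ℕ → ℤ) (p : ℕ × ℤ) (M : Multiset (ℕ × ℤ)) :
    Zc v (p ::ₘ M) = (if v p.1 - p.2 = 0 then p.1 else 0) + Zc v M := by simp [Zc]

theorem Zc_cl (v : ℕ → ℤ) (M : Multiset (ℕ × ℤ)) : Zc v (cl M) = Zc v M := by
  induction M using Multiset.induction_on with
  | empty => simp [cl]
  | cons p M ih =>
    obtain ⟨l, x⟩ := p
    rcases Nat.eq_zero_or_pos l with rfl | hl
    · rw [cl_cons_zero, Zc_cons, ih]; simp
    · rw [cl_cons_pos hl, Zc_cons, Zc_cons, ih]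

theorem vac_zz {A : I → I → ℤ} {a : I} (ha : A a a = 0) {ν ν' : RCraw I} (h : Good ν)
    (h' : Good ν') (ho : ∀ b, b ≠ a → ∀ i, ss (mn i) (ν' b) = ss (mn i) (ν b)) :
    vac A ν' a = vac A ν a := by
  funext i
  rw [vac_split A a a h, vac_split A a a h', W_congr A a a (mn i) (fun b hb => ho b hb i), ha]
  ring

theorem TE_zero {A : I → I → ℤ} {a : I} (ha : A a a = 0) (n : ℕ) {ν : RCraw I} (h : Good ν)
    (hr : ∀ p ∈ ν a, 0 ≤ vac A ν a p.1 - p.2) (hn : Zc (vac A ν a) (ν a) = n) :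
    TE A a ν n := by
  induction n generalizing ν with
  | zero =>
    refine TE.zero ν ?_
    unfold eStarOp
    rw [if_neg (by omega), if_pos]
    by_cases h0 : ν a = 0
    · exact Or.inl h0
    · right
      intro hm
      have hs : corigs A ν a ≠ 0 := by
        unfold corigs; simpa using h0
      obtain ⟨h1, -⟩ := minPosRows_spec hs
      rw [hm, ha] at h1
      obtain ⟨p, hp, h2⟩ := Multiset.mem_map.1 h1
      obtain ⟨N, hN⟩ := Multiset.exists_cons_of_mem hp
      rw [hN, Zc_cons, if_pos (by simpa using h2)] at hn
      have := h.1 a p hp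
      omega
  | succ n ih =>
    have hm : (0 : ℤ) ∈ (ν a).map (fun p => vac A ν a p.1 - p.2) := by
      by_contra hc
      have : Zc (vac A ν a) (ν a) = 0 := by
        unfold Zc
        rw [Multiset.map_congr (g := fun _ => 0) rfl]
        · simp
        · intro p hp
          rw [if_neg]
          intro h0
          exact hc (Multiset.mem_map.2 ⟨p, hp, h0⟩)
      omega
    obtain ⟨N, k, r, h1, h2, h3⟩ := exists_minrow (h.1 a) hm
    simp only at h2
    have hr0 : r = vac A ν a (k + 1) - 0 := by omega
    have he := eStar_eq (A := A) (x := 0) (k := k) (N := N) ha.le (by rw [ha]; rfl) (h.1 a)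
      (by rw [h1, hr0]) (fun p hp => ⟨hr p (by rw [h1]; exact Multiset.mem_cons_of_mem hp), h3 p hp⟩)
    refine TE.succ ν _ n he ?_
    have hg := good_S (A := A) (a := a) (N := N) (k := k) (x := 0) h
    have hv : vac A (SRes A a ν N k 0) a = vac A ν a := by
      apply vac_zz ha h hg
      intro b hb i
      simp only [SRes, if_neg hb]
    have hs : SRes A a ν N k 0 a = cl ((k, vac A ν a k) ::ₘ N) := by
      simp [SRes, ha]
    apply ih hg
    · intro p hp
      rw [hv]
      rw [hs] at hp
      rcases mem_cl_cons hp with ⟨rfl, _⟩ | hp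
      · simp
      · exact hr p (by rw [h1]; exact Multiset.mem_cons_of_mem hp)
    · rw [hv, hs, Zc_cl, Zc_cons]
      rw [h1, Zc_cons] at hn
      simp only [hr0, sub_zero, sub_self, if_true] at hn ⊢
      omega

theorem te_f_zero {A : I → I → ℤ} (hA : IsBorcherdsCartan A) {a : I} (ha : A a a = 0)
    {ν : RCraw I} (hν : SS A ν) (hT : 0 < T A a ν 0) :
    teStarRC A a (fOp A a ν) = teStarRC A a ν := by
  have hg := hν.good
  have hi := hν.invZ hA ha
  have hi' := (hν.f hA a).invZ hA ha
  have hg' := (hν.f hA a).good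
  rw [(TE_zero ha _ hg (fun p hp => (hi.r p hp).2) rfl).eq,
    (TE_zero ha _ hg' (fun p hp => (hi'.r p hp).2) rfl).eq]
  obtain ⟨N, k, y, hF⟩ := exists_FSpec a (hg.1 a)
  have hy := hi.fx hF
  subst hy
  have hpos := vacZ_pos hA ha hg hT
  rw [fOp_eq A hF] at hg' ⊢
  have hv : vac A (FRes A a ν N k 0) a = vac A ν a := by
    apply vac_zz ha hg hg'
    intro b hb i
    simp only [FRes, if_neg hb, ss_sh]
  have hs : FRes A a ν N k 0 a = (k + 1, 0) ::ₘ N := by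
    simp [FRes, ha, sh_zero]
  rw [hv, hs, hF.eq, Zc_cl, Zc_cons, Zc_cons]
  have e1 := hpos k
  simp only [sub_zero]
  rw [if_neg (by omega)]
  rcases Nat.eq_zero_or_pos k with rfl | hk
  · simp
  · have e2 := hpos (k - 1)
    rw [Nat.sub_add_cancel hk] at e2
    rw [if_neg (by omega)]

/-! ### Negative diagonal entry -/

/-- The action of `e_a^*` on the coriggings if `A a a = -2 h < 0`. -/
inductive TC (h : ℤ) : Multiset ℤ → ℕ → Prop
  | zero (C : Multiset ℤ) : ¬ (h ∈ C ∧ ∀ z ∈ C, h ≤ z) → TC h C 0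
  | succ (C : Multiset ℤ) (n : ℕ) : (∀ z ∈ C, h ≤ z) → TC h (C.map fun z => z - 2 * h) n →
      TC h (h ::ₘ C) (n + 1)

theorem TC_exists (h : ℤ) (m : ℕ) (C : Multiset ℤ) (hm : Multiset.card C = m) :
    ∃ t, t ≤ m ∧ TC h C t := by
  induction m generalizing C with
  | zero =>
    refine ⟨0, le_rfl, TC.zero C ?_⟩
    rw [Multiset.card_eq_zero.1 hm]; simp
  | succ m ih =>
    by_cases hc : h ∈ C ∧ ∀ z ∈ C, h ≤ z
    · obtain ⟨h1, h2⟩ := hc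
      obtain ⟨D, rfl⟩ := Multiset.exists_cons_of_mem h1
      obtain ⟨t, ht, h3⟩ := ih (D.map fun z => z - 2 * h) (by simpa using hm)
      exact ⟨t + 1, by omega, TC.succ D t (fun z hz => h2 z (Multiset.mem_cons_of_mem hz)) h3⟩
    · exact ⟨0, by omega, TC.zero C hc⟩

theorem TC_cons {h : ℤ} (hh : 0 < h) {C : Multiset ℤ} {t : ℕ} (hC : TC h C t) {c U : ℤ}
    (hU : 0 ≤ U) (hpos : 0 < 2 * h * ((Multiset.card C : ℤ) - t) + U)
    (hc : c = 2 * h * (Multiset.card C : ℤ) + h + U) : TC h (c ::ₘ C) t := by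
  induction hC generalizing c with
  | zero C h0 =>
    refine TC.zero _ ?_
    rintro ⟨h1, h2⟩
    apply h0
    refine ⟨?_, fun z hz => h2 z (Multiset.mem_cons_of_mem hz)⟩
    rcases Multiset.mem_cons.1 h1 with h1 | h1
    · exfalso
      simp only [Nat.cast_zero, sub_zero] at hpos
      linarith
    · exact h1
  | succ C n h1 h2 ih =>
    rw [Multiset.card_cons] at hpos hc
    push_cast at hpos hc
    rw [Multiset.cons_swap]
    have hcc : 0 ≤ 2 * h * (Multiset.card C : ℤ) := by positivity
    refine TC.succ _ _ ?_ ?_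
    · intro z hz
      rcases Multiset.mem_cons.1 hz with rfl | hz
      · linarith
      · exact h1 z hz
    · rw [Multiset.map_cons]
      apply ih
      · rw [Multiset.card_map]; linarith
      · rw [Multiset.card_map]; linarith

theorem TE_neg {A : I → I → ℤ} {a : I} {h : ℤ} (hh : 0 < h) (ha : A a a = -2 * h)
    {C : Multiset ℤ} {n : ℕ} (hC : TC h C n) {ν : RCraw I} (hg : Good ν)
    (hr : ∀ p ∈ ν a, p.1 = 1) (e : corigs A ν a = C) : TE A a ν n := by
  have hx : h = -A a a / 2 := by omega
  induction hC generalizing ν with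
  | zero C h0 =>
    refine TE.zero _ ?_
    unfold eStarOp
    rw [if_neg (by omega), if_pos]
    by_cases hz : ν a = 0
    · exact Or.inl hz
    · right
      intro hm
      have hs : corigs A ν a ≠ 0 := by
        unfold corigs; simpa using hz
      obtain ⟨h1, h2⟩ := minPosRows_spec hs
      rw [hm, ← hx, e] at h1 h2
      exact h0 ⟨h1, h2⟩
  | succ C n h1 h2 ih =>
    obtain ⟨p, hp, hph⟩ := Multiset.mem_map.1
      (show h ∈ corigs A ν a by rw [e]; exact Multiset.mem_cons_self _ _)
    obtain ⟨N, hN⟩ := Multiset.exists_cons_of_mem hp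
    have hrN : ∀ q ∈ N, q.1 = 1 := fun q hq => hr q (by rw [hN]; exact Multiset.mem_cons_of_mem hq)
    have hCN : N.map (fun q => vac A ν a q.1 - q.2) = C := by
      unfold corigs at e
      rw [hN, Multiset.map_cons, hph] at e
      exact (Multiset.cons_inj_right h).1 e
    have hp1 := hr p hp
    obtain ⟨l, r⟩ := p
    simp only at hp1 hph
    subst hp1
    have hr' : r = vac A ν a (0 + 1) - h := by rw [zero_add]; omega
    have he := eStar_eq (A := A) (x := h) (k := 0) (N := N) (by omega : A a a ≤ 0) hx (hg.1 a)
      (by rw [hN, hr']) (fun q hq => ⟨h1 _ (by rw [← hCN]; exact Multiset.mem_map_of_mem _ hq),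
        fun _ => by rw [hrN q hq]⟩)
    refine TE.succ ν _ n he ?_
    have hgS := good_S (A := A) (a := a) (N := N) (k := 0) (x := h) hg
    have hPN : Pos N := fun q hq => by rw [hrN q hq]; exact Nat.one_pos
    have hs : SRes A a ν N 0 h a = N := by
      simp only [SRes, if_true, cl_cons_zero, cl_eq hPN]
    have hv : vac A (SRes A a ν N 0 h) a 1 = vac A ν a 1 - 2 * h := by
      rw [vac_one hg, vac_one hgS, hs, hN, Multiset.card_cons, T_congr (ν := ν), ha]
      · push_cast; ring
      · intro b hb
        simp only [SRes, if_neg hb]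
    apply ih hgS
    · rw [hs]; exact hrN
    · unfold corigs
      rw [hs, ← hCN, Multiset.map_map]
      apply Multiset.map_congr rfl
      intro q hq
      simp only [Function.comp, hrN q hq, hv]
      ring

theorem rcSize_ones {ν : RCraw I} {a : I} (hr : ∀ p ∈ ν a, p.1 = 1) :
    rcSize ν a = (Multiset.card (ν a) : ℤ) := by
  unfold rcSize
  rw [Multiset.map_congr (g := fun _ => (1 : ℤ)) rfl]
  · simp
  · intro p hp; simp [hr p hp]

theorem kappa_zero {A : I → I → ℤ} {a : I} (ha : A a a = 0) {ν : RCraw I} (hg : Good ν) :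
    kappaRC A a ν = W A a a ν (fun j => (j : ℤ)) := by
  unfold kappaRC
  rw [pInf_split A a a hg, ha]; ring

theorem neg_data {A : I → I → ℤ} (hA : IsBorcherdsCartan A) {a : I} {h : ℤ} (hh : 0 < h)
    (ha : A a a = -2 * h) {ν : RCraw I} (hν : SS A ν) :
    ∃ t : ℕ, t ≤ Multiset.card (ν a) ∧ TC h (corigs A ν a) t ∧ teStarRC A a ν = t ∧
      kappaRC A a ν = 2 * h * ((Multiset.card (ν a) : ℤ) - t) + W A a a ν (fun j => (j : ℤ)) := by
  have hg := hν.good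
  have hi := hν.invN hA hh ha
  have hr : ∀ p ∈ ν a, p.1 = 1 := fun p hp => (hi.r p hp).1
  obtain ⟨t, ht, hC⟩ := TC_exists h _ (corigs A ν a) (Multiset.card_map _ _)
  have hte := (TE_neg hh ha hC hg hr rfl).eq
  refine ⟨t, ht, hC, hte, ?_⟩
  unfold kappaRC
  rw [hte, pInf_split A a a hg, rcSize_ones hr, ha]; ring

theorem te_f_neg {A : I → I → ℤ} (hA : IsBorcherdsCartan A) {a : I} {h : ℤ} (hh : 0 < h)
    (ha : A a a = -2 * h) {ν : RCraw I} (hν : SS A ν) (hk : 0 < kappaRC A a ν) :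
    teStarRC A a (fOp A a ν) = teStarRC A a ν := by
  obtain ⟨t, ht, hC, hte, hkt⟩ := neg_data hA hh ha hν
  have hg := hν.good
  have hi := hν.invN hA hh ha
  obtain ⟨w1, w2⟩ := Wid hA a hg
  have hT := T_nonneg hA a ν 0
  have ht' : (0 : ℤ) ≤ (Multiset.card (ν a) : ℤ) - t := by omega
  have hm : 0 ≤ 2 * h * ((Multiset.card (ν a) : ℤ) - t) := by positivity
  have hcard : Multiset.card (corigs A ν a) = Multiset.card (ν a) := Multiset.card_map _ _
  have hpos : 0 < 2 * h * ((Multiset.card (corigs A ν a) : ℤ) - t) + T A a ν 0 := by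
    rw [hcard]
    rcases eq_or_lt_of_le hT with h0 | h0
    · have := w2 h0.symm
      linarith
    · linarith
  have hC' := TC_cons hh hC hT hpos rfl
  rw [hte]
  have hi' := (hν.f hA a).invN hA hh ha
  have hg' := (hν.f hA a).good
  apply TE.eq
  refine TE_neg hh ha hC' hg' (fun p hp => (hi'.r p hp).1) ?_
  have hF := hi.fspec hg hh
  rw [fOp_eq A hF]
  have hv := vac_F (A := A) (x := 0) hg hF.pos hF.eq a 1
  rw [if_pos Nat.one_pos] at hv
  have hv1 := vac_one (A := A) (a := a) hg
  have hs : FRes A a ν (ν a) 0 0 a = (1, h) ::ₘ sh (A a a) 0 (ν a) := by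
    have : 0 - A a a / 2 = h := by omega
    simp only [FRes, if_true, this]
  unfold corigs
  rw [hs, Multiset.map_cons, hv, hv1, ha, Multiset.card_map]
  congr 1
  · ring
  · unfold sh
    rw [Multiset.map_map]
    apply Multiset.map_congr rfl
    intro p hp
    have hp1 := (hi.r p hp).1
    simp only [Function.comp, hp1, hv, Nat.one_pos, if_true, ha]
    ring

theorem main {A : I → I → ℤ} (hA : IsBorcherdsCartan A) (a : I) (ha : A a a ≤ 0) (ν : RCraw I)
    (h : RCinf A ν) : (kappaRC A a ν = 0 → fOp A a ν = fStar A a ν) ∧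
      (0 < kappaRC A a ν → teStarRC A a (fOp A a ν) = teStarRC A a ν) := by
  have hν := RCinf.ss hA h
  have hg := hν.good
  obtain ⟨w1, w2⟩ := Wid hA a hg
  have hT := T_nonneg hA a ν 0
  rcases imag_cases hA ha with h0 | ⟨m, h1, h2⟩
  · rw [kappa_zero h0 hg]
    refine ⟨fun hk => im1 hA ha hν (by omega), fun hk => te_f_zero hA h0 hν ?_⟩
    by_contra hc
    have := w2 (by omega)
    omega
  · refine ⟨fun hk => im1 hA ha hν ?_, te_f_neg hA h1 h2 hν⟩
    obtain ⟨t, ht, hC, hte, hkt⟩ := neg_data hA h1 h2 hν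
    have ht' : (0 : ℤ) ≤ (Multiset.card (ν a) : ℤ) - t := by omega
    have hm : 0 ≤ 2 * m * ((Multiset.card (ν a) : ℤ) - t) := by positivity
    rw [hk] at hkt
    linarith

end RCProof

/-- For imaginary `a` and `(ν,J) ∈ RC(∞)`: if `κ_a(ν,J) = 0` then
`f_a(ν,J) = f_a^*(ν,J)`, and if `κ_a(ν,J) > 0` then
`tε_a^*(f_a(ν,J)) = tε_a^*(ν,J)`. -/
theorem rc_kappa_f_fstar {I : Type*} [DecidableEq I] (A : I → I → ℤ)
    (hA : IsBorcherdsCartan A) :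
    ∀ a : I, A a a ≤ 0 → ∀ ν : RCraw I, RCinf A ν →
      (kappaRC A a ν = 0 → fOp A a ν = fStar A a ν) ∧
      (0 < kappaRC A a ν → teStarRC A a (fOp A a ν) = teStarRC A a ν) := by
  exact fun a ha ν h => RCProof.main hA a ha ν h
end

section
/- Suppose I = I^im (the Borcherds–Cartan matrix is purely imaginary) and let a ≠ a' in I. If A_{aa'} = 0, then f_a f_{a'}(ν,J) = f_{a'} f_a(ν,J) for every (ν,J) ∈ RC(∞). If A_{aa'} ≠ 0, then for every (ν,J) ∈ RC(∞) with e_a(ν,J) ≠ 0 and every integer k ≥ 1, e_a(f_{a'}^k(ν,J)) = 0. -/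
variable {I : Type*} [DecidableEq I]

/-- The value of `fOp` once the modified row is known. -/
def fVal (A : I → I → ℤ) (a : I) (ν : RCraw I) (l : ℕ) (R : Multiset (ℕ × ℤ)) : RCraw I :=
  fun b =>
    let adj : Multiset (ℕ × ℤ) → Multiset (ℕ × ℤ) :=
      Multiset.map fun p => (p.1, p.2 - if l < p.1 then A b a else 0)
    if b = a then adj R + {(l + 1, -A a a / 2)} else adj (ν b)

/-- A row of color `a` attains the threshold rigging. -/
def Thr (A : I → I → ℤ) (a : I) (ν : RCraw I) : Prop := ∃ p ∈ ν a, p.2 = -A a a / 2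

/-- Invariant of `RC(∞)` in the purely imaginary case. -/
structure RCInv (A : I → I → ℤ) (ν : RCraw I) : Prop where
  len : ∀ a, ∀ p ∈ ν a, 1 ≤ p.1
  rig : ∀ a, ∀ p ∈ ν a, -A a a / 2 ≤ p.2
  uniq : ∀ a, A a a = 0 → ∀ l R, ν a = (l, 0) ::ₘ R → ∀ p ∈ R, 0 < p.2
  excl : ∀ a b, a ≠ b → A a b ≠ 0 → Thr A a ν → ¬ Thr A b ν

/-- Elements generated by the operators `f_a` alone. -/
inductive RCf (A : I → I → ℤ) : RCraw I → Prop
  | empty : RCf A emptyRC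
  | fstep (a : I) (ν : RCraw I) : RCf A ν → RCf A (fOp A a ν)

lemma fold_min_nonneg (s : Multiset ℤ) (h : ∀ x ∈ s, 0 ≤ x) : s.fold min 0 = 0 := by
  induction s using Multiset.induction with
  | empty => simp
  | cons x s ih =>
    rw [Multiset.fold_cons_left, ih (fun y hy => h y (Multiset.mem_cons_of_mem hy))]
    exact min_eq_right (h x (Multiset.mem_cons_self x s))

lemma fold_min_le' (b : ℤ) (s : Multiset ℤ) : ∀ x ∈ s, s.fold min b ≤ x := by
  induction s using Multiset.induction with
  | empty => simp
  | cons y s ih =>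
    intro x hx
    rw [Multiset.fold_cons_left]
    rcases Multiset.mem_cons.1 hx with rfl | hx
    · exact min_le_left _ _
    · exact (min_le_right _ _).trans (ih x hx)

lemma le_fold_max' (b : ℤ) (s : Multiset ℤ) : ∀ x ∈ s, x ≤ s.fold max b := by
  induction s using Multiset.induction with
  | empty => simp
  | cons y s ih =>
    intro x hx
    rw [Multiset.fold_cons_left]
    rcases Multiset.mem_cons.1 hx with rfl | hx
    · exact le_max_left _ _
    · exact (ih x hx).trans (le_max_right _ _)

lemma fold_min_mem (b : ℤ) (s : Multiset ℤ) : s.fold min b = b ∨ s.fold min b ∈ s := by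
  induction s using Multiset.induction with
  | empty => simp
  | cons y s ih =>
    rw [Multiset.fold_cons_left]
    rcases min_choice y (s.fold min b) with h | h <;> rw [h]
    · right; simp
    · rcases ih with h | h
      · exact Or.inl h
      · exact Or.inr (Multiset.mem_cons_of_mem h)

lemma minPosRows_mem {s : Multiset ℤ} (h : s ≠ 0) : minPosRows s ∈ s := by
  unfold minPosRows
  rcases fold_min_mem (s.fold max 0) s with h1 | h1
  · obtain ⟨x, hx⟩ := Multiset.exists_mem_of_ne_zero h
    have h2 := fold_min_le' (s.fold max 0) s x hx
    have h3 := le_fold_max' 0 s x hx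
    have : s.fold min (s.fold max 0) = x := by omega
    rw [this]; exact hx
  · exact h1

lemma eOp_ne_none_iff {A : I → I → ℤ} (him : ∀ a : I, A a a ≤ 0) {ν : RCraw I}
    {a : I} (h : ∀ p ∈ ν a, -A a a / 2 ≤ p.2) : eOp A a ν ≠ none ↔ Thr A a ν := by
  have h2 : A a a ≠ 2 := by have := him a; omega
  unfold eOp Thr
  rw [if_neg h2]
  constructor
  · intro hh
    split_ifs at hh with hc
    · exact absurd rfl hh
    · push Not at hc
      have := minPosRows_mem (s := (ν a).map Prod.snd) (by simpa using hc.1)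
      rw [hc.2] at this
      simpa using this
  · rintro ⟨p, hp, hpe⟩
    have hne : ν a ≠ 0 := by rintro h0; rw [h0] at hp; simp at hp
    rw [if_neg]
    · simp
    · push Not
      refine ⟨hne, ?_⟩
      have h1 := minPosRows_mem (s := (ν a).map Prod.snd) (by simpa using hne)
      have h3 : minPosRows ((ν a).map Prod.snd) ≤ p.2 :=
        fold_min_le' _ _ _ (Multiset.mem_map_of_mem _ hp)
      obtain ⟨q, hq, hqe⟩ := Multiset.mem_map.1 h1
      have := h q hq
      omega

lemma eOp_of_thr {A : I → I → ℤ} (him : ∀ a : I, A a a ≤ 0) {ν : RCraw I}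
    {a : I} (h : ∀ p ∈ ν a, -A a a / 2 ≤ p.2) (ht : Thr A a ν) :
    eOp A a ν = some (eRemove A a ν (-A a a / 2)) := by
  have := (eOp_ne_none_iff him h).2 ht
  have h2 : A a a ≠ 2 := by have := him a; omega
  unfold eOp at this ⊢
  rw [if_neg h2] at this ⊢
  split_ifs at this ⊢ with hc
  · exact absurd rfl this
  · rfl

/-- Explicit form of `fOp` on configurations satisfying the invariant. -/
lemma fOp_form {A : I → I → ℤ} (hA : IsBorcherdsCartan A) (him : ∀ a : I, A a a ≤ 0)
    {ν : RCraw I} (h : RCInv A ν) (a : I) :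
    ∃ l R, ((ν a = R ∧ l = 0) ∨ (ν a = (l, 0) ::ₘ R ∧ 1 ≤ l ∧ A a a = 0)) ∧
      (∀ p ∈ R, 0 < p.2) ∧ fOp A a ν = fVal A a ν l R := by
  have hev : Even (A a a) := by
    rcases hA.diag a with h | h
    · have := him a; omega
    · exact h.2
  obtain ⟨k, hk⟩ := hev
  have ha := him a
  have hx : minWith0 ((ν a).map Prod.snd) = 0 := by
    apply fold_min_nonneg
    intro x hx
    obtain ⟨p, hp, rfl⟩ := Multiset.mem_map.1 hx
    have := h.rig a p hp
    omega
  by_cases hz : ∃ p ∈ ν a, p.2 = 0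
  · obtain ⟨⟨l, y⟩, hp, hy⟩ := hz
    simp only at hy
    subst hy
    obtain ⟨R, hR⟩ := Multiset.exists_cons_of_mem hp
    have h0 : A a a = 0 := by have := h.rig a _ hp; simp only at this; omega
    have hpos := h.uniq a h0 l R hR
    refine ⟨l, R, Or.inr ⟨hR, h.len a _ hp, h0⟩, hpos, ?_⟩
    have hfil : (ν a).filter (fun p => p.2 = 0) = {(l, 0)} := by
      rw [hR, Multiset.filter_cons_of_pos (p := fun p : ℕ × ℤ => p.2 = 0) _ rfl, Multiset.filter_eq_nil.2]
      · rfl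
      · intro p hp; have := hpos p hp; omega
    have her : (ν a).erase (l, 0) = R := by rw [hR]; simp
    unfold fOp fVal
    simp only [hx, hfil, maxWith0, Multiset.map_singleton, Multiset.fold_singleton, Nat.max_zero,
      her]
    funext b
    have : (0 : ℤ) - A a a / 2 = -A a a / 2 := by omega
    rw [this]
  · have hz' : ∀ p ∈ ν a, 0 < p.2 := by
      intro p hp
      have := h.rig a p hp
      have : p.2 ≠ 0 := fun h => hz ⟨p, hp, h⟩
      omega
    refine ⟨0, ν a, Or.inl ⟨rfl, rfl⟩, hz', ?_⟩
    have hfil : (ν a).filter (fun p => p.2 = 0) = 0 := by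
      rw [Multiset.filter_eq_nil]
      intro p hp; have := hz' p hp; omega
    have her : (ν a).erase (0, 0) = ν a := by
      apply Multiset.erase_of_notMem
      intro hm; have := h.len a _ hm; simp at this
    unfold fOp fVal
    simp only [hx, hfil, maxWith0, Multiset.map_zero, Multiset.fold_zero, her]
    funext b
    have : (0 : ℤ) - A a a / 2 = -A a a / 2 := by omega
    rw [this]

lemma fOp_other (A : I → I → ℤ) {a b : I} (hab : b ≠ a) (ν : RCraw I) :
    ∃ l : ℕ, fOp A a ν b =
      (ν b).map fun p => (p.1, p.2 - if l < p.1 then A b a else 0) := by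
  unfold fOp
  simp only [if_neg hab]
  exact ⟨_, rfl⟩

lemma fOp_other_zero {A : I → I → ℤ} {a b : I} (hab : b ≠ a) (h0 : A b a = 0) (ν : RCraw I) :
    fOp A a ν b = ν b := by
  obtain ⟨l, hl⟩ := fOp_other A hab ν
  rw [hl]; simp [h0]

lemma Thr_of_fOp {A : I → I → ℤ} (hA : IsBorcherdsCartan A) {a b : I} (hab : b ≠ a)
    {ν : RCraw I} (hr : ∀ p ∈ ν b, -A b b / 2 ≤ p.2) (h : Thr A b (fOp A a ν)) : Thr A b ν := by
  obtain ⟨l, hl⟩ := fOp_other A hab ν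
  obtain ⟨q, hq, hqe⟩ := h
  rw [hl] at hq
  obtain ⟨p, hp, rfl⟩ := Multiset.mem_map.1 hq
  have := hr p hp
  have := hA.offdiag b a hab
  refine ⟨p, hp, ?_⟩
  simp only at hqe
  split_ifs at hqe <;> omega

lemma not_Thr_fOp {A : I → I → ℤ} (hA : IsBorcherdsCartan A) (him : ∀ a : I, A a a ≤ 0)
    {a b : I} (hab : b ≠ a) (h0 : A b a ≠ 0)
    {ν : RCraw I} (h : RCInv A ν) : ¬ Thr A b (fOp A a ν) := by
  intro ht
  have ht0 := Thr_of_fOp hA hab (h.rig b) ht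
  have hn := h.excl b a hab h0 ht0
  obtain ⟨l, R, hR, hpos, hf⟩ := fOp_form hA him h a
  have hl : l = 0 := by
    rcases hR with ⟨_, h⟩ | ⟨hR, _, haa⟩
    · exact h
    · exact absurd ⟨(l, 0), by rw [hR]; simp, by simp [haa]⟩ hn
  subst hl
  obtain ⟨q, hq, hqe⟩ := ht
  rw [hf] at hq
  simp only [fVal, if_neg hab] at hq
  obtain ⟨p, hp, rfl⟩ := Multiset.mem_map.1 hq
  have h1 := h.rig b p hp
  have h2 := h.len b p hp
  have h3 := hA.offdiag b a hab
  simp only at hqe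
  rw [if_pos (by omega)] at hqe
  omega

lemma Inv_empty (A : I → I → ℤ) : RCInv A (emptyRC : RCraw I) := by
  constructor
  · intro a p hp; simp [emptyRC] at hp
  · intro a p hp; simp [emptyRC] at hp
  · intro a _ l R h; simp [emptyRC] at h
  · rintro a b _ _ ⟨p, hp, _⟩; simp [emptyRC] at hp

lemma Inv_fOp {A : I → I → ℤ} (hA : IsBorcherdsCartan A) (him : ∀ a : I, A a a ≤ 0)
    {ν : RCraw I} (h : RCInv A ν) (a : I) : RCInv A (fOp A a ν) := by
  obtain ⟨l, R, hR, hpos, hf⟩ := fOp_form hA him h a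
  have hRsub : ∀ p ∈ R, p ∈ ν a := by
    intro p hp
    rcases hR with ⟨h, _⟩ | ⟨h, _⟩ <;> rw [h] <;> simp [hp]
  have ha := him a
  constructor
  · intro b p hp
    by_cases hb : b = a
    · subst hb
      rw [hf] at hp
      simp only [fVal, if_true, Multiset.mem_add, Multiset.mem_map, Multiset.mem_singleton] at hp
      rcases hp with ⟨q, hq, rfl⟩ | rfl
      · exact h.len b q (hRsub q hq)
      · simp
    · obtain ⟨l, hl⟩ := fOp_other A hb ν
      rw [hl] at hp
      obtain ⟨q, hq, rfl⟩ := Multiset.mem_map.1 hp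
      exact h.len b q hq
  · intro b p hp
    by_cases hb : b = a
    · subst hb
      rw [hf] at hp
      simp only [fVal, if_true, Multiset.mem_add, Multiset.mem_map, Multiset.mem_singleton] at hp
      rcases hp with ⟨q, hq, rfl⟩ | rfl
      · have := h.rig b q (hRsub q hq)
        simp only
        split_ifs <;> omega
      · simp
    · obtain ⟨l, hl⟩ := fOp_other A hb ν
      rw [hl] at hp
      obtain ⟨q, hq, rfl⟩ := Multiset.mem_map.1 hp
      have := h.rig b q hq
      have := hA.offdiag b a hb
      simp only
      split_ifs <;> omega
  · intro b hbb l' R' hR'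
    by_cases hb : b = a
    · subst hb
      rw [hf] at hR'
      simp only [fVal, if_true, hbb] at hR'
      simp only [ite_self, sub_zero, Prod.mk.eta, Multiset.map_id', neg_zero, Int.zero_ediv] at hR'
      rw [add_comm, Multiset.singleton_add, Multiset.cons_eq_cons] at hR'
      rcases hR' with ⟨_, rfl⟩ | ⟨_, cs, h1, h2⟩
      · exact hpos
      · have := hpos (l', 0) (by rw [h1]; simp)
        simp at this
    · obtain ⟨l, hl⟩ := fOp_other A hb ν
      have hr := h.rig b
      have hoff := hA.offdiag b a hb
      rw [hl] at hR'
      obtain ⟨q, hq, hqe, hqR⟩ := Multiset.map_eq_cons _ _ _ _ |>.2 hR'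
      have hq2 : q = (q.1, 0) := by
        have := hr q hq
        have h2 : (q.2 - if l < q.1 then A b a else 0) = 0 := congrArg Prod.snd hqe
        ext
        · rfl
        · simp only
          rw [hbb] at this
          split_ifs at h2 <;> omega
      have hpos' := h.uniq b hbb q.1 ((ν b).erase q) (by
        rw [← hq2]; exact (Multiset.cons_erase hq).symm)
      intro p hp
      rw [← hqR] at hp
      obtain ⟨p', hp', rfl⟩ := Multiset.mem_map.1 hp
      have := hpos' p' hp'
      simp only
      split_ifs <;> omega
  · intro b c hbc hA0 hb hc
    by_cases hba : b = a
    · subst hba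
      exact not_Thr_fOp hA him hbc.symm (fun h0 => hA0 ((hA.zero_iff _ _).1 h0)) h hc
    by_cases hca : c = a
    · subst hca
      exact not_Thr_fOp hA him hbc hA0 h hb
    exact h.excl b c hbc hA0 (Thr_of_fOp hA hba (h.rig b) hb) (Thr_of_fOp hA hca (h.rig c) hc)

lemma Inv_RCf {A : I → I → ℤ} (hA : IsBorcherdsCartan A) (him : ∀ a : I, A a a ≤ 0)
    {ν : RCraw I} (h : RCf A ν) : RCInv A ν := by
  induction h with
  | empty => exact Inv_empty A
  | fstep a ν _ ih => exact Inv_fOp hA him ih a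

lemma eRemove_fOp {A : I → I → ℤ} (hA : IsBorcherdsCartan A) (him : ∀ a : I, A a a ≤ 0)
    {ν : RCraw I} (h : RCInv A ν) (a : I) : eRemove A a (fOp A a ν) (-A a a / 2) = ν := by
  have hev : Even (A a a) := by
    rcases hA.diag a with h | h
    · have := him a; omega
    · exact h.2
  obtain ⟨k, hk⟩ := hev
  have ha := him a
  obtain ⟨l, R, hR, hpos, hf⟩ := fOp_form hA him h a
  have hRsub : ∀ p ∈ R, p ∈ ν a := by
    intro p hp
    rcases hR with ⟨h, _⟩ | ⟨h, _⟩ <;> rw [h] <;> simp [hp]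
  have hfa : fOp A a ν a = (l + 1, -A a a / 2) ::ₘ
      R.map (fun p => (p.1, p.2 - if l < p.1 then A a a else 0)) := by
    rw [hf]; simp only [fVal, if_true]; rw [add_comm, Multiset.singleton_add]
  have hfil : (fOp A a ν a).filter (fun p => p.2 = -A a a / 2) = {(l + 1, -A a a / 2)} := by
    rw [hfa, Multiset.filter_cons_of_pos (p := fun p : ℕ × ℤ => p.2 = -A a a / 2) _ rfl, Multiset.filter_eq_nil.2]
    · rfl
    · intro p hp
      obtain ⟨q, hq, rfl⟩ := Multiset.mem_map.1 hp
      have h1 := hpos q hq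
      have h2 := h.rig a q (hRsub q hq)
      have h3 := h.len a q (hRsub q hq)
      simp only
      rcases hR with ⟨_, hl⟩ | ⟨_, _, hl⟩
      · rw [if_pos (by omega)]; omega
      · rw [hl]; simp; omega
  have her : (fOp A a ν a).erase (l + 1, -A a a / 2) =
      R.map (fun p => (p.1, p.2 - if l < p.1 then A a a else 0)) := by
    rw [hfa]; simp
  have hmin : minPosRowsN {l + 1} = l + 1 := by
    unfold minPosRowsN
    rw [Multiset.fold_singleton, Multiset.fold_singleton]
    omega
  have hcomp : ∀ (b : I) (M : Multiset (ℕ × ℤ)),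
      (M.map (fun p => (p.1, p.2 - if l < p.1 then A b a else 0))).map
        (fun p => (p.1, p.2 + if l + 1 ≤ p.1 then A b a else 0)) = M := by
    intro b M
    rw [Multiset.map_map]
    conv_rhs => rw [← Multiset.map_id M]
    apply Multiset.map_congr rfl
    intro p _
    simp only [Function.comp, Nat.succ_le_iff, sub_add_cancel, id]
  unfold eRemove
  simp only [hfil, her, Multiset.map_singleton, hmin]
  funext b
  by_cases hb : b = a
  · subst hb
    rw [if_pos rfl, hcomp]
    rcases hR with ⟨h1, h2⟩ | ⟨h1, h2, h3⟩
    · simp [h1, h2]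
    · rw [if_neg (by omega), h1, h3, add_comm, Multiset.singleton_add]; simp
  · rw [if_neg hb, hf]
    simp only [fVal, if_neg hb]
    exact hcomp b _

lemma eRemove_other_zero {A : I → I → ℤ} {a b : I} (hab : b ≠ a) (h0 : A b a = 0) (ν : RCraw I)
    (x : ℤ) : eRemove A a ν x b = ν b := by
  unfold eRemove; simp [if_neg hab, h0]

lemma fOp_congr_self {A : I → I → ℤ} {a : I} {ν μ : RCraw I} (h : ν a = μ a) :
    fOp A a ν a = fOp A a μ a := by
  unfold fOp; simp [h]

lemma eRemove_congr_self {A : I → I → ℤ} {a : I} {ν μ : RCraw I} (h : ν a = μ a) (x : ℤ) :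
    eRemove A a ν x a = eRemove A a μ x a := by
  unfold eRemove; simp [h]

lemma fOp_comm {A : I → I → ℤ} {a b : I} (hab : a ≠ b) (h1 : A a b = 0) (h2 : A b a = 0)
    (ν : RCraw I) : fOp A a (fOp A b ν) = fOp A b (fOp A a ν) := by
  have e1 := fOp_other_zero hab h1 ν
  have e2 := fOp_other_zero hab.symm h2 ν
  funext c
  by_cases ca : c = a
  · subst ca
    rw [fOp_other_zero hab h1, fOp_congr_self e1]
  by_cases cb : c = b
  · subst cb
    rw [fOp_other_zero ca h2, fOp_congr_self e2]
  · conv_lhs => rw [fOp]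
    conv_rhs => rw [fOp]
    simp only [if_neg ca, if_neg cb, e1, e2]
    simp only [fOp, if_neg ca, if_neg cb, Multiset.map_map]
    apply Multiset.map_congr rfl
    intro p _
    simp only [Function.comp, sub_right_comm]

lemma eRemove_fOp_comm {A : I → I → ℤ} {a b : I} (hab : a ≠ b) (h1 : A a b = 0) (h2 : A b a = 0)
    (ν : RCraw I) (x : ℤ) : eRemove A a (fOp A b ν) x = fOp A b (eRemove A a ν x) := by
  have e1 := fOp_other_zero hab h1 ν
  have e2 := eRemove_other_zero hab.symm h2 ν x
  funext c
  by_cases ca : c = a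
  · subst ca
    rw [fOp_other_zero hab h1, eRemove_congr_self e1]
  by_cases cb : c = b
  · subst cb
    rw [eRemove_other_zero ca h2, fOp_congr_self e2]
  · conv_lhs => rw [eRemove]
    conv_rhs => rw [fOp]
    simp only [if_neg ca, if_neg cb, e1, e2]
    simp only [fOp, eRemove, if_neg ca, if_neg cb, Multiset.map_map]
    apply Multiset.map_congr rfl
    intro p _
    simp only [Function.comp, sub_add_eq_add_sub]

lemma Thr_fOp_self {A : I → I → ℤ} (a : I) {ν : RCraw I} (hA : IsBorcherdsCartan A)
    (him : ∀ a : I, A a a ≤ 0) (h : RCInv A ν) : Thr A a (fOp A a ν) := by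
  obtain ⟨l, R, hR, hpos, hf⟩ := fOp_form hA him h a
  refine ⟨(l + 1, -A a a / 2), ?_, rfl⟩
  rw [hf]; simp [fVal]

lemma RCf_eOp {A : I → I → ℤ} (hA : IsBorcherdsCartan A) (him : ∀ a : I, A a a ≤ 0)
    {ν : RCraw I} (h : RCf A ν) (a : I) :
    Thr A a ν → RCf A (eRemove A a ν (-A a a / 2)) := by
  induction h with
  | empty => rintro ⟨p, hp, _⟩; simp [emptyRC] at hp
  | fstep b ν hν ih =>
    intro ht
    have hi := Inv_RCf hA him hν
    by_cases hab : a = b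
    · subst hab
      rw [eRemove_fOp hA him hi]; exact hν
    · by_cases h0 : A a b = 0
      · rw [eRemove_fOp_comm hab h0 ((hA.zero_iff _ _).1 h0)]
        exact RCf.fstep _ _ (ih (Thr_of_fOp hA hab (hi.rig a) ht))
      · exact absurd ht (not_Thr_fOp hA him hab h0 hi)

lemma RCf_of_RCinf {A : I → I → ℤ} (hA : IsBorcherdsCartan A) (him : ∀ a : I, A a a ≤ 0)
    {ν : RCraw I} (h : RCinf A ν) : RCf A ν := by
  induction h with
  | empty => exact RCf.empty
  | fstep a ν _ ih => exact RCf.fstep a ν ih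
  | estep a ν ν' _ he ih =>
    have hi := Inv_RCf hA him ih
    have ht : Thr A a ν := (eOp_ne_none_iff him (hi.rig a)).1 (by rw [he]; simp)
    rw [eOp_of_thr him (hi.rig a) ht, Option.some.injEq] at he
    rw [← he]
    exact RCf_eOp hA him ih a ht

lemma iterate_no_Thr {A : I → I → ℤ} (hA : IsBorcherdsCartan A) (him : ∀ a : I, A a a ≤ 0)
    {a b : I} (hab : a ≠ b) (h0 : A a b ≠ 0) (k : ℕ) :
    ∀ ν : RCraw I, RCInv A ν → RCInv A ((fOp A b)^[k + 1] ν) ∧ ¬ Thr A a ((fOp A b)^[k + 1] ν) := by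
  induction k with
  | zero => intro ν h; exact ⟨Inv_fOp hA him h b, not_Thr_fOp hA him hab h0 h⟩
  | succ k ih =>
    intro ν h
    rw [Function.iterate_succ_apply]
    exact ih _ (Inv_fOp hA him h b)


/-- In the purely imaginary case, for `a ≠ a'`: if `A a a' = 0` then `f_a` and `f_{a'}`
commute on `RC(∞)`; if `A a a' ≠ 0` then for every `(ν,J) ∈ RC(∞)` with
`e_a(ν,J) ≠ 0` and every `k ≥ 1`, `e_a(f_{a'}^k(ν,J)) = 0`. -/
theorem rc_purely_imaginary_free_or_commute {I : Type*} [DecidableEq I] (A : I → I → ℤ)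
    (hA : IsBorcherdsCartan A) (him : ∀ a : I, A a a ≤ 0) :
    ∀ a a' : I, a ≠ a' →
      (A a a' = 0 → ∀ ν : RCraw I, RCinf A ν →
        fOp A a (fOp A a' ν) = fOp A a' (fOp A a ν)) ∧
      (A a a' ≠ 0 → ∀ ν : RCraw I, RCinf A ν → eOp A a ν ≠ none →
        ∀ k : ℕ, 1 ≤ k → eOp A a ((fOp A a')^[k] ν) = none) := by
  intro a a' hne
  refine ⟨fun h0 ν _ => fOp_comm hne h0 ((hA.zero_iff _ _).1 h0) ν, ?_⟩
  intro h0 ν hν _ k hk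
  obtain ⟨k, rfl⟩ : ∃ j, k = j + 1 := ⟨k - 1, by omega⟩
  obtain ⟨hi, ht⟩ := iterate_no_Thr hA him hne h0 k ν (Inv_RCf hA him (RCf_of_RCinf hA him hν))
  by_contra hc
  exact ht ((eOp_ne_none_iff him (hi.rig a)).1 hc)
end
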